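/- arXiv:1003.1079 — 8 statements merged into one kernel-verified Lean document; each statement's English description precedes it below -/
import Mathlib

section
/- Let f : P(E) → ℤ be a submodular function on a finite set E with B_f nonempty, and let F ⊆ B_f be a nonempty face of B_f of dimension |E| − t. Then there exist a partition E = E1 ∪ ⋯ ∪ Et into pairwise disjoint nonempty sets and submodular functions f_i : P(E_i) → ℤ such that F = B_{f1} ⊕ ⋯ ⊕ B_{ft}. In particular, every face of a base polytope is itself the base polytope of a submodular function. -/
open Finset

/-- A set function on subsets of a finite type `E` is submodular:
`f ∅ = 0` and `f (A ∪ B) + f (A ∩ B) ≤ f A + f B` for all `A B`. -/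
def Submodular {E : Type*} [DecidableEq E] (f : Finset E → ℤ) : Prop :=
  f ∅ = 0 ∧ ∀ A B : Finset E, f (A ∪ B) + f (A ∩ B) ≤ f A + f B

/-- The base polytope `B_f` of a submodular function `f`:
`{x : x(U) ≤ f(U) for all U, x(E) = f(E)}`. -/
def basePolytope {E : Type*} [Fintype E] (f : Finset E → ℤ) : Set (E → ℝ) :=
  {x | (∀ U : Finset E, ∑ e ∈ U, x e ≤ (f U : ℝ)) ∧ ∑ e, x e = (f Finset.univ : ℝ)}

/-- A vector is integral if all its coordinates are integers. -/
def IsIntegerVec {E : Type*} (x : E → ℝ) : Prop := ∀ e, ∃ n : ℤ, x e = n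

/-- The integer points of the base polytope of `f`. -/
def intBasePoints {E : Type*} [Fintype E] (f : Finset E → ℤ) : Set (E → ℝ) :=
  {x ∈ basePolytope f | IsIntegerVec x}

/-- The integer cone generated by `H`: all nonnegative integer combinations
of elements of `H`. -/
def intCone {E : Type*} (H : Set (E → ℝ)) : Set (E → ℝ) :=
  {w | ∃ (k : ℕ) (c : Fin k → ℕ) (v : Fin k → (E → ℝ)),
    (∀ i, v i ∈ H) ∧ w = ∑ i, (c i : ℝ) • v i}

/-- `t` bounds the Carathéodory rank of `H`: every element of the integer cone of `H`
is a nonnegative integer combination of at most `t` elements of `H`. -/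
def IsCRBound {E : Type*} (H : Set (E → ℝ)) (t : ℕ) : Prop :=
  ∀ w ∈ intCone H, ∃ (k : ℕ) (c : Fin k → ℕ) (v : Fin k → (E → ℝ)),
    k ≤ t ∧ (∀ i, v i ∈ H) ∧ w = ∑ i, (c i : ℝ) • v i

/-- The Carathéodory rank of `H`: the least `t` such that every element of the
integer cone of `H` is a nonnegative integer combination of at most `t` elements of `H`. -/
noncomputable def carathRank {E : Type*} (H : Set (E → ℝ)) : ℕ :=
  sInf {t | IsCRBound H t}

/-- `F` is an (exposed) face of `P`: the set of maximizers over `P`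
of some linear functional. -/
def IsFaceOf {E : Type*} [Fintype E] (P F : Set (E → ℝ)) : Prop :=
  ∃ c : E → ℝ, F = {x ∈ P | ∀ y ∈ P, ∑ e, c e * y e ≤ ∑ e, c e * x e}

/-- The constraint of the base polytope indexed by `U` holds with equality at `x`. -/
def IsTight {E : Type*} (f : Finset E → ℤ) (x : E → ℝ) (U : Finset E) : Prop :=
  ∑ e ∈ U, x e = (f U : ℝ)

section BasePolytope

open Filter Topology

variable {E : Type*} {f : Finset E → ℤ} {x : E → ℝ}

theorem isTight_univ [Fintype E] (hx : x ∈ basePolytope f) : IsTight f x Finset.univ := hx.2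

variable [DecidableEq E]

theorem isTight_empty (hf : Submodular f) : IsTight f x ∅ := by
  simp [IsTight, hf.1]

theorem sum_add_smul_single_sub_single (x : E → ℝ) (ε : ℝ) (u v : E) (U : Finset E) :
    ∑ e ∈ U, (x + ε • (Pi.single u 1 - Pi.single v 1) : E → ℝ) e =
      ∑ e ∈ U, x e + ε * ((if u ∈ U then 1 else 0) - (if v ∈ U then 1 else 0)) := by
  simp [Finset.sum_add_distrib, ← Finset.mul_sum, Finset.sum_sub_distrib, Pi.single_apply]

/-- The set function `U ↦ f (A ∪ U) - f A` on the subsets of `S`. -/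
def contractRestrict (f : Finset E → ℤ) (A S : Finset E) : Finset {e // e ∈ S} → ℤ :=
  fun U => f (A ∪ U.map (Function.Embedding.subtype _)) - f A

theorem Submodular.contractRestrict (hf : Submodular f) (A S : Finset E) :
    Submodular (contractRestrict f A S) := by
  refine ⟨by simp [_root_.contractRestrict], fun U V => ?_⟩
  have h := hf.2 (A ∪ U.map (Function.Embedding.subtype _))
    (A ∪ V.map (Function.Embedding.subtype _))
  rw [← Finset.union_union_distrib_left, ← Finset.union_inter_distrib_left] at h
  simp only [_root_.contractRestrict, Finset.map_union, Finset.map_inter]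
  linarith

theorem restrict_mem_basePolytope_contractRestrict_iff {A S : Finset E} :
    (fun e : {e // e ∈ S} => x e.val) ∈ basePolytope (contractRestrict f A S) ↔
      (∀ U ⊆ S, ∑ e ∈ U, x e ≤ (f (A ∪ U) : ℝ) - f A) ∧
        ∑ e ∈ S, x e = (f (A ∪ S) : ℝ) - f A := by
  have hS : (Finset.univ : Finset {e // e ∈ S}).map (Function.Embedding.subtype _) = S := by
    ext e
    simp
  have hsum : ∀ U : Finset {e // e ∈ S},
      ∑ e ∈ U, x e.val = ∑ e ∈ U.map (Function.Embedding.subtype _), x e := fun U => by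
    rw [Finset.sum_map]
    rfl
  simp only [basePolytope, Set.mem_ofPred_eq, contractRestrict, Int.cast_sub, hsum, hS]
  refine and_congr_left fun _ => ⟨fun h U hU => ?_, fun h U => h _ fun e he => ?_⟩
  · have := h (U.subtype (· ∈ S))
    rwa [Finset.subtype_map_of_mem hU] at this
  · obtain ⟨a, _, rfl⟩ := Finset.mem_map.mp he
    exact a.2

/-- If the sums of `x` are bounded by the contractions of `f` along a chain, then they are bounded
by `f`. -/
theorem sum_le_of_chain (hf : Submodular f) {k : ℕ} {T : ℕ → Finset E} (h0 : T 0 = ∅)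
    (h : ∀ n < k, ∀ U ⊆ T (n + 1) \ T n, ∑ e ∈ U, x e ≤ (f (T n ∪ U) : ℝ) - f (T n)) :
    ∀ n ≤ k, ∀ U ⊆ T n, ∑ e ∈ U, x e ≤ (f U : ℝ) := by
  intro n
  induction n with
  | zero =>
    intro _ U hU
    rw [h0, Finset.subset_empty] at hU
    simp [hU, hf.1]
  | succ n ih =>
    intro hn U hU
    have h1 := ih (by omega) (U ∩ T n) Finset.inter_subset_right
    have h2 := h n (by omega) (U \ T n) (Finset.sdiff_subset_sdiff hU le_rfl)
    have h3 : ((f (U ∪ T n) + f (U ∩ T n) : ℤ) : ℝ) ≤ ((f U + f (T n) : ℤ) : ℝ) :=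
      Int.cast_le.mpr (hf.2 U (T n))
    have h4 := Finset.sum_inter_add_sum_sdiff U (T n) x
    rw [Finset.union_sdiff_self_eq_union, Finset.union_comm] at h2
    push_cast at h3
    linarith

variable [Fintype E]

theorem IsTight.union_and_inter (hf : Submodular f) (hx : x ∈ basePolytope f) {A B : Finset E}
    (hA : IsTight f x A) (hB : IsTight f x B) :
    IsTight f x (A ∪ B) ∧ IsTight f x (A ∩ B) := by
  unfold IsTight at *
  have h1 := hx.1 (A ∪ B)
  have h2 := hx.1 (A ∩ B)
  have h3 := Finset.sum_union_inter (s₁ := A) (s₂ := B) (f := x)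
  have h4 : ((f (A ∪ B) + f (A ∩ B) : ℤ) : ℝ) ≤ ((f A + f B : ℤ) : ℝ) :=
    Int.cast_le.mpr (hf.2 A B)
  push_cast at h4
  constructor <;> linarith

/-- If tight sets separate every element of `U` from every element outside `U`, then `U` is
tight. -/
theorem isTight_of_separated (hf : Submodular f) (hx : x ∈ basePolytope f) {U : Finset E}
    (h : ∀ u ∈ U, ∀ v ∉ U, ∃ W, IsTight f x W ∧ u ∈ W ∧ v ∉ W) : IsTight f x U := by
  have hinter : ∀ u ∈ U, ∃ W, IsTight f x W ∧ u ∈ W ∧ W ⊆ U := by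
    intro u hu
    choose! W hW using h u hu
    refine ⟨Uᶜ.inf W, ?_, ?_, ?_⟩
    · refine Finset.inf_induction (isTight_univ hx)
        (fun A hA B hB => (IsTight.union_and_inter hf hx hA hB).2) ?_
      exact fun v hv => (hW v (Finset.mem_compl.mp hv)).1
    · have : {u} ≤ Uᶜ.inf W := Finset.le_inf fun v hv => by
        simpa using (hW v (Finset.mem_compl.mp hv)).2.1
      exact this (Finset.mem_singleton_self u)
    · intro v hv
      by_contra hvU
      exact (hW v hvU).2.2 (Finset.inf_le (f := W) (Finset.mem_compl.mpr hvU) hv)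
  choose! W hW using hinter
  have : U = U.sup W := by
    refine le_antisymm (fun u hu => ?_) (Finset.sup_le fun u hu => (hW u hu).2.2)
    exact Finset.le_sup (f := W) hu (hW u hu).2.1
  rw [this]
  exact Finset.sup_induction (isTight_empty hf)
    (fun A hA B hB => (IsTight.union_and_inter hf hx hA hB).1) fun u hu => (hW u hu).1

/-- If no tight set contains `u` without containing `v`, then one can move mass from `v` to `u`
inside the base polytope. -/
theorem exists_exchange_mem (hx : x ∈ basePolytope f) {u v : E}
    (h : ∀ W, IsTight f x W → u ∈ W → v ∈ W) :
    ∃ ε > (0 : ℝ), x + ε • (Pi.single u 1 - Pi.single v 1) ∈ basePolytope f := by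
  have hev : ∀ᶠ ε in 𝓝[>] (0 : ℝ), ∀ U : Finset E, ¬ IsTight f x U →
      ε < (f U : ℝ) - ∑ e ∈ U, x e := by
    refine Filter.eventually_all.mpr fun U => ?_
    by_cases hU : IsTight f x U
    · simp [hU]
    · have hpos : (0 : ℝ) < (f U : ℝ) - ∑ e ∈ U, x e :=
        sub_pos.mpr (lt_of_le_of_ne (hx.1 U) hU)
      filter_upwards [nhdsWithin_le_nhds (Iio_mem_nhds hpos)] with ε hε _ using hε
  obtain ⟨ε, hε, hpos⟩ := (hev.and self_mem_nhdsWithin).exists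
  have hpos' : (0 : ℝ) < ε := hpos
  refine ⟨ε, hpos', fun U => ?_, ?_⟩
  · rw [sum_add_smul_single_sub_single]
    have hle := hx.1 U
    by_cases hU : IsTight f x U
    · have := h U hU
      split_ifs <;> first | linarith | tauto
    · have := hε U hU
      split_ifs <;> linarith
  · rw [sum_add_smul_single_sub_single]
    simpa using hx.2

/-- Strict upper level sets of the objective are tight at every maximizer. -/
theorem isTight_of_isMaximizer (hf : Submodular f) (hx : x ∈ basePolytope f) {c : E → ℝ}
    (hmax : ∀ y ∈ basePolytope f, ∑ e, c e * y e ≤ ∑ e, c e * x e) {U : Finset E}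
    (hU : ∀ u ∈ U, ∀ v ∉ U, c v < c u) : IsTight f x U := by
  refine isTight_of_separated hf hx fun u hu v hv => ?_
  by_contra! hcon
  obtain ⟨ε, hε, hmem⟩ := exists_exchange_mem hx hcon
  have h := hmax _ hmem
  have hsum : ∑ e, c e * (x + ε • (Pi.single u 1 - Pi.single v 1) : E → ℝ) e =
      ∑ e, c e * x e + ε * (c u - c v) := by
    simp [mul_add, mul_sub, Finset.sum_add_distrib, Finset.sum_sub_distrib, Pi.single_apply,
      mul_comm]
  have := mul_pos hε (sub_pos.mpr (hU u hu v hv))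
  linarith

/-- A linear functional vanishes on a vector whose sums over all strict upper level sets of the
functional vanish. -/
theorem sum_mul_eq_zero_of_levelSets {c d : E → ℝ}
    (h : ∀ U : Finset E, (∀ u ∈ U, ∀ v ∉ U, c v < c u) → ∑ e ∈ U, d e = 0) :
    ∑ e, c e * d e = 0 := by
  rw [← Finset.sum_fiberwise_of_maps_to (t := Finset.univ.image c) (g := c)
    (fun e _ => Finset.mem_image_of_mem c (Finset.mem_univ e))]
  refine Finset.sum_eq_zero fun r _ => ?_
  have h1 := h (Finset.univ.filter fun e => r ≤ c e) fun u hu v hv => by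
    simp at hu hv; linarith
  have h2 := h (Finset.univ.filter fun e => r < c e) fun u hu v hv => by
    simp at hu hv; linarith
  have h3 : ∑ e with r ≤ c e, d e = ∑ e with r < c e, d e + ∑ e with c e = r, d e := by
    rw [← Finset.sum_union]
    · congr 1
      ext e
      simp [le_iff_lt_or_eq, eq_comm]
    · rw [Finset.disjoint_left]
      intro e he he'
      simp at he he'
      linarith
  have h4 : ∑ e with c e = r, c e * d e = r * ∑ e with c e = r, d e := by
    rw [Finset.mul_sum]
    exact Finset.sum_congr rfl fun e he => by simp at he; rw [he]
  rw [h4]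
  have : ∑ e with c e = r, d e = 0 := by linarith
  rw [this, mul_zero]

/-- A nonempty face of a base polytope contains a point whose tight sets are tight on the whole
face, and the face is cut out by these tight sets. -/
theorem IsFaceOf.exists_generic (hf : Submodular f) {F : Set (E → ℝ)}
    (hF : IsFaceOf (basePolytope f) F) (hne : F.Nonempty) :
    ∃ x ∈ basePolytope f,
      F = {y ∈ basePolytope f | ∀ U, IsTight f x U → IsTight f y U} := by
  classical
  obtain ⟨c, rfl⟩ := hF
  obtain ⟨x, hx, hmin⟩ := WellFounded.has_min
    (measure fun y : E → ℝ => (Finset.univ.filter fun U => IsTight f y U).card).wf _ hne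
  have hsub : ∀ y ∈ basePolytope f, (∀ z ∈ basePolytope f, ∑ e, c e * z e ≤ ∑ e, c e * y e) →
      ∀ U, IsTight f x U → IsTight f y U := by
    intro y hy hymax U hU
    by_contra hyU
    have hsum : ∀ (W : Finset E) (a : E → ℝ),
        ∑ e ∈ W, a e * ((1 / 2 : ℝ) • (x + y)) e =
          (∑ e ∈ W, a e * x e + ∑ e ∈ W, a e * y e) / 2 := by
      intro W a
      rw [← Finset.sum_add_distrib, Finset.sum_div]
      refine Finset.sum_congr rfl fun e _ => ?_
      simp only [Pi.smul_apply, Pi.add_apply, smul_eq_mul]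
      ring
    have hsum1 : ∀ W : Finset E, ∑ e ∈ W, ((1 / 2 : ℝ) • (x + y)) e =
        (∑ e ∈ W, x e + ∑ e ∈ W, y e) / 2 := by
      intro W
      simpa only [one_mul] using hsum W fun _ => 1
    have hz : (1 / 2 : ℝ) • (x + y) ∈ basePolytope f := by
      refine ⟨fun W => ?_, ?_⟩
      · rw [hsum1]
        linarith [hx.1.1 W, hy.1 W]
      · rw [hsum1]
        linarith [hx.1.2, hy.2]
    have hlt : (Finset.univ.filter fun W => IsTight f ((1 / 2 : ℝ) • (x + y)) W) ⊂
        Finset.univ.filter fun W => IsTight f x W := by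
      refine (Finset.ssubset_iff_of_subset fun W hW => ?_).mpr ⟨U, by simpa using hU, ?_⟩
      · have hW' := (Finset.mem_filter.mp hW).2
        refine Finset.mem_filter.mpr ⟨Finset.mem_univ W, ?_⟩
        unfold IsTight at hW' ⊢
        rw [hsum1] at hW'
        have h1 := hx.1.1 W
        have h2 := hy.1 W
        linarith
      · simp only [Finset.mem_filter, Finset.mem_univ, true_and, IsTight, hsum1] at hU hyU ⊢
        intro h
        apply hyU
        linarith
    refine hmin _ ⟨hz, fun z hz => ?_⟩ (Finset.card_lt_card hlt)
    rw [hsum]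
    linarith [hx.2 z hz, hymax z hz]
  refine ⟨x, hx.1, Set.ext fun y => ⟨fun hy => ⟨hy.1, hsub y hy.1 hy.2⟩, fun hy => ⟨hy.1, ?_⟩⟩⟩
  have h0 : ∑ e, c e * (y e - x e) = 0 := by
    refine sum_mul_eq_zero_of_levelSets fun U hU => ?_
    have h1 := isTight_of_isMaximizer hf hx.1 hx.2 hU
    have h2 := hy.2 U h1
    unfold IsTight at h1 h2
    rw [Finset.sum_sub_distrib, h1, h2, sub_self]
  simp only [mul_sub, Finset.sum_sub_distrib] at h0
  intro z hz
  linarith [hx.2 z hz]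

/-- A maximal chain from `A` to the full set in a family of finite sets. -/
theorem exists_saturated_chain_from (L : Set (Finset E)) (huniv : Finset.univ ∈ L)
    (A : Finset E) (hA : A ∈ L) :
    ∃ (k : ℕ) (T : ℕ → Finset E), T 0 = A ∧ T k = Finset.univ ∧ Monotone T ∧ (∀ n, T n ∈ L) ∧
      (∀ n < k, T n ≠ T (n + 1)) ∧
      ∀ n, ∀ W ∈ L, T n ⊆ W → W ⊆ T (n + 1) → W = T n ∨ W = T (n + 1) := by
  induction A using WellFoundedGT.induction with
  | _ A ih =>
    by_cases hAu : A = Finset.univ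
    · exact ⟨0, fun _ => Finset.univ, hAu.symm, rfl, fun _ _ _ => le_rfl, fun _ => huniv,
        fun n hn => absurd hn (Nat.not_lt_zero n),
        fun n W _ h1 h2 => Or.inl (Finset.Subset.antisymm h2 h1)⟩
    · obtain ⟨B, hB, hmin⟩ := WellFounded.has_min (wellFounded_lt (α := Finset E))
        {B | B ∈ L ∧ A < B} ⟨Finset.univ, huniv, lt_of_le_of_ne (Finset.subset_univ A) hAu⟩
      obtain ⟨k, T, h0, hk, hmono, hL, hneq, hcov⟩ := ih B hB.2 hB.1
      refine ⟨k + 1, fun n => Nat.casesOn n A T, rfl, hk, ?_, ?_, ?_, ?_⟩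
      · refine monotone_nat_of_le_succ fun n => ?_
        cases n with
        | zero => simpa [h0] using hB.2.le
        | succ n => exact hmono (Nat.le_succ n)
      · rintro (_ | n)
        exacts [hA, hL n]
      · rintro (_ | n) hn
        · simpa [h0] using hB.2.ne
        · exact hneq n (by omega)
      · rintro (_ | n) W hW h1 h2
        · by_cases hWA : W = A
          · exact Or.inl hWA
          · right
            simp only [h0] at h1 h2 ⊢
            by_contra hWB
            exact hmin W ⟨hW, lt_of_le_of_ne h1 (Ne.symm hWA)⟩ (lt_of_le_of_ne h2 hWB)
        · exact hcov n W hW h1 h2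

/-- A chain from the empty set to the full set sorts the elements by its successive
differences. -/
theorem exists_chain_index {k : ℕ} {T : ℕ → Finset E} (h0 : T 0 = ∅) (hk : T k = Finset.univ)
    (hmono : Monotone T) : ∃ idx : E → Fin k, ∀ e i, idx e = i ↔ e ∈ T (i + 1) \ T i := by
  have hex : ∀ e, ∃ i : Fin k, e ∈ T (i + 1) \ T i := by
    intro e
    have hk' : ∃ n, e ∈ T n := ⟨k, by simp [hk]⟩
    have hpos : Nat.find hk' ≠ 0 := fun h => by
      have := Nat.find_spec hk'
      simp [h, h0] at this
    obtain ⟨m, hm⟩ := Nat.exists_eq_succ_of_ne_zero hpos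
    have hle : Nat.find hk' ≤ k := Nat.find_min' hk' (by simp [hk])
    refine ⟨⟨m, by omega⟩, Finset.mem_sdiff.mpr ⟨?_, Nat.find_min hk' (hm ▸ Nat.lt_succ_self m)⟩⟩
    have := Nat.find_spec hk'
    rwa [hm] at this
  choose idx hidx using hex
  refine ⟨idx, fun e i => ⟨fun h => h ▸ hidx e, fun h => ?_⟩⟩
  have h1 := Finset.mem_sdiff.mp (hidx e)
  have h2 := Finset.mem_sdiff.mp h
  by_contra hne
  rcases lt_or_gt_of_ne (fun h => hne (Fin.ext h) : (idx e : ℕ) ≠ i) with hlt | hlt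
  · exact h2.2 (hmono hlt h1.1)
  · exact h1.2 (hmono hlt h2.1)

/-- The linear map sending a vector to its sums over the fibers of `idx`. -/
def fiberSum {ι : Type*} [DecidableEq ι] (idx : E → ι) : (E → ℝ) →ₗ[ℝ] (ι → ℝ) where
  toFun d i := ∑ e with idx e = i, d e
  map_add' d d' := by
    ext i
    simp [Finset.sum_add_distrib]
  map_smul' r d := by
    ext i
    simp [Finset.mul_sum]

theorem finrank_ker_fiberSum {ι : Type*} [DecidableEq ι] [Fintype ι] {idx : E → ι}
    (hidx : Function.Surjective idx) :
    Module.finrank ℝ (LinearMap.ker (fiberSum idx)) + Fintype.card ι = Fintype.card E := by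
  have hsurj : Function.Surjective (fiberSum idx) := by
    obtain ⟨rep, hrep⟩ := hidx.hasRightInverse
    intro y
    refine ⟨fun e => if e = rep (idx e) then y (idx e) else 0, ?_⟩
    ext i
    change ∑ e with idx e = i, (if e = rep (idx e) then y (idx e) else 0) = y i
    rw [Finset.sum_eq_single (rep i)]
    · simp [hrep i]
    · intro e he hne
      simp only [Finset.mem_filter, Finset.mem_univ, true_and] at he
      rw [he, if_neg hne]
    · simp [hrep i]
  have h := LinearMap.finrank_range_add_finrank_ker (fiberSum idx)
  rw [LinearMap.range_eq_top.mpr hsurj, finrank_top, Module.finrank_fintype_fun_eq_card,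
    Module.finrank_fintype_fun_eq_card] at h
  omega

theorem ker_fiberSum_le {ι : Type*} [DecidableEq ι] [Fintype ι] {idx : E → ι}
    (hidx : Function.Surjective idx) {V : Submodule ℝ (E → ℝ)}
    (hV : ∀ u v, idx u = idx v → (Pi.single u 1 - Pi.single v 1 : E → ℝ) ∈ V) :
    LinearMap.ker (fiberSum idx) ≤ V := by
  intro d hd
  obtain ⟨rep, hrep⟩ := hidx.hasRightInverse
  have hzero : ∑ e, d e • (Pi.single (rep (idx e)) 1 : E → ℝ) = 0 := by
    rw [← Finset.sum_fiberwise_of_maps_to (t := Finset.univ) (g := idx)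
      (fun e _ => Finset.mem_univ _)]
    refine Finset.sum_eq_zero fun i _ => ?_
    have h1 : ∑ e with idx e = i, d e • (Pi.single (rep (idx e)) 1 : E → ℝ) =
        (∑ e with idx e = i, d e) • (Pi.single (rep i) 1 : E → ℝ) := by
      rw [Finset.sum_smul]
      refine Finset.sum_congr rfl fun e he => ?_
      rw [(Finset.mem_filter.mp he).2]
    have h2 : ∑ e with idx e = i, d e = 0 := congrFun (LinearMap.mem_ker.mp hd) i
    rw [h1, h2, zero_smul]
  have hsum : d = ∑ e, d e • (Pi.single e 1 - Pi.single (rep (idx e)) 1 : E → ℝ) := by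
    simp only [smul_sub, Finset.sum_sub_distrib, hzero, sub_zero]
    exact pi_eq_sum_univ' d
  rw [hsum]
  exact V.sum_mem fun e _ => V.smul_mem _ (hV _ _ (hrep (idx e)).symm)

end BasePolytope

/-- Let `F` be a nonempty face of `B_f` of dimension `|E| - t`. Then there is
a partition `E = E₁ ∪ ⋯ ∪ E_t` into pairwise disjoint nonempty sets and submodular functions
`f_i : P(E_i) → ℤ` with `F = B_{f₁} ⊕ ⋯ ⊕ B_{f_t}`; in particular every face of a base
polytope is itself a base polytope. -/
theorem face_of_basePolytope_is_directSum {E : Type*} [Fintype E] [DecidableEq E]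
    (f : Finset E → ℤ) (hf : Submodular f) (hne : (basePolytope f).Nonempty)
    (t : ℕ) (F : Set (E → ℝ)) (hF : IsFaceOf (basePolytope f) F) (hFne : F.Nonempty)
    (hdim : Fintype.card E = Module.finrank ℝ (vectorSpan ℝ F) + t) :
    ∃ P : Fin t → Finset E,
      (∀ i, (P i).Nonempty) ∧
      (∀ i j, i ≠ j → Disjoint (P i) (P j)) ∧
      Finset.univ.biUnion P = Finset.univ ∧
      ∃ g : (i : Fin t) → Finset {e // e ∈ P i} → ℤ,
        (∀ i, Submodular (g i)) ∧
        F = {x | ∀ i, (fun e : {e // e ∈ P i} => x e.val) ∈ basePolytope (g i)} := by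
  obtain ⟨x₀, hx₀, hFeq⟩ := hF.exists_generic hf hFne
  have hx₀F : x₀ ∈ F := hFeq ▸ ⟨hx₀, fun _ h => h⟩
  obtain ⟨k, T, h0, hk, hmono, hL, hneq, hcov⟩ := exists_saturated_chain_from
    {U | IsTight f x₀ U} (isTight_univ hx₀) ∅ (isTight_empty hf)
  obtain ⟨idx, hidx⟩ := exists_chain_index h0 hk hmono
  have hnonempty : ∀ i : Fin k, (T (i + 1) \ T i).Nonempty := fun i =>
    Finset.sdiff_nonempty.mpr fun h =>
      hneq i i.2 (Finset.Subset.antisymm (hmono (Nat.le_succ _)) h)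
  have hsurj : Function.Surjective idx := fun i =>
    (hnonempty i).imp fun e he => (hidx e i).mpr he
  have hfiber : ∀ i, (Finset.univ.filter fun e => idx e = i) = T (i + 1) \ T i := fun i => by
    ext e
    simp only [Finset.mem_filter, Finset.mem_univ, true_and, hidx]
  have hblock : ∀ U, IsTight f x₀ U → ∀ i : Fin k,
      U ∩ (T (i + 1) \ T i) = ∅ ∨ U ∩ (T (i + 1) \ T i) = T (i + 1) \ T i := by
    intro U hU i
    have hW := (IsTight.union_and_inter hf hx₀ (IsTight.union_and_inter hf hx₀ hU
      (hL (i + 1))).2 (hL i)).1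
    have hsub := hmono (Nat.le_succ (i : ℕ))
    rcases hcov i _ hW Finset.subset_union_right
      (Finset.union_subset Finset.inter_subset_right hsub) with h | h
    · left
      ext e
      have := Finset.ext_iff.mp h e
      simp only [Finset.mem_union, Finset.mem_inter, Finset.mem_sdiff, Finset.notMem_empty] at *
      tauto
    · right
      ext e
      have := Finset.ext_iff.mp h e
      simp only [Finset.mem_union, Finset.mem_inter, Finset.mem_sdiff] at *
      tauto
  have hblockSum : ∀ x ∈ F, ∀ i : Fin k,
      ∑ e ∈ T (i + 1) \ T i, x e = (f (T (i + 1)) : ℝ) - f (T i) := by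
    intro x hx i
    rw [hFeq] at hx
    have h1 : ∑ e ∈ T (i + 1), x e = (f (T (i + 1)) : ℝ) := hx.2 _ (hL _)
    have h2 : ∑ e ∈ T i, x e = (f (T i) : ℝ) := hx.2 _ (hL _)
    rw [← h1, ← h2, ← Finset.sum_sdiff (hmono (Nat.le_succ (i : ℕ))), add_sub_cancel_right]
  have hker : LinearMap.ker (fiberSum idx) = vectorSpan ℝ F := by
    refine le_antisymm (ker_fiberSum_le hsurj fun u v huv => ?_) (Submodule.span_le.mpr ?_)
    · have hsep : ∀ W, IsTight f x₀ W → (u ∈ W ↔ v ∈ W) := by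
        intro W hW
        have hu := (hidx u _).mp rfl
        have hv := (hidx v _).mp huv.symm
        rcases hblock W hW (idx u) with h | h
        · have h1 := Finset.ext_iff.mp h u
          have h2 := Finset.ext_iff.mp h v
          simp only [Finset.mem_inter, hu, hv, and_true, Finset.notMem_empty] at h1 h2
          tauto
        · have h1 := Finset.ext_iff.mp h u
          have h2 := Finset.ext_iff.mp h v
          simp only [Finset.mem_inter, hu, hv, and_true] at h1 h2
          tauto
      obtain ⟨ε, hε, hmem⟩ := exists_exchange_mem hx₀ fun W hW => (hsep W hW).mp
      have hmemF : x₀ + ε • (Pi.single u 1 - Pi.single v 1) ∈ F := by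
        rw [hFeq]
        refine ⟨hmem, fun W hW => ?_⟩
        have := hsep W hW
        unfold IsTight at *
        rw [sum_add_smul_single_sub_single, hW]
        simp [this]
      have := (vectorSpan ℝ F).smul_mem ε⁻¹ (vsub_mem_vectorSpan ℝ hmemF hx₀F)
      simpa [smul_smul, inv_mul_cancel₀ hε.ne'] using this
    · rintro _ ⟨x, hx, y, hy, rfl⟩
      refine LinearMap.mem_ker.mpr (funext fun i => ?_)
      change ∑ e with idx e = i, (x e - y e) = 0
      rw [hfiber, Finset.sum_sub_distrib, hblockSum x hx, hblockSum y hy, sub_self]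
  have hrank := finrank_ker_fiberSum hsurj
  rw [hker, Fintype.card_fin, hdim] at hrank
  obtain rfl : k = t := by omega
  refine ⟨fun i => T (i + 1) \ T i, hnonempty, fun i j hij => ?_, ?_,
    fun i => contractRestrict f (T i) (T (i + 1) \ T i), fun i => hf.contractRestrict _ _, ?_⟩
  · refine Finset.disjoint_left.mpr fun e hi hj => hij ?_
    rw [← (hidx e i).mpr hi, ← (hidx e j).mpr hj]
  · ext e
    simpa only [Finset.mem_biUnion, Finset.mem_univ, true_and, iff_true] using
      ⟨idx e, (hidx e _).mp rfl⟩
  · have hunion : ∀ n, T n ∪ T (n + 1) \ T n = T (n + 1) := fun n =>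
      Finset.union_sdiff_of_subset (hmono (Nat.le_succ n))
    ext x
    simp only [Set.mem_ofPred_eq, restrict_mem_basePolytope_contractRestrict_iff, hunion]
    constructor
    · refine fun hx i => ⟨fun U hU => ?_, hblockSum x hx i⟩
      rw [hFeq] at hx
      have h1 : ∑ e ∈ T i, x e = (f (T i) : ℝ) := hx.2 _ (hL _)
      have h2 := hx.1.1 (T i ∪ U)
      rw [Finset.sum_union (Finset.disjoint_of_subset_right hU Finset.disjoint_sdiff)] at h2
      linarith
    · intro hx
      have htight : ∀ U, IsTight f x₀ U → IsTight f x U := by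
        intro U hU
        have hsplit : ∀ y : E → ℝ,
            ∑ e ∈ U, y e = ∑ i : Fin k, ∑ e ∈ U ∩ (T (i + 1) \ T i), y e := by
          intro y
          rw [← Finset.sum_fiberwise_of_maps_to (t := Finset.univ) (g := idx)
            (fun e _ => Finset.mem_univ _)]
          refine Finset.sum_congr rfl fun i _ => Finset.sum_congr ?_ fun _ _ => rfl
          rw [← hfiber i]
          ext e
          simp
        have hU' : ∑ e ∈ U, x₀ e = (f U : ℝ) := hU
        unfold IsTight
        rw [← hU', hsplit x, hsplit x₀]
        refine Finset.sum_congr rfl fun i _ => ?_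
        rcases hblock U hU i with h | h
        · simp [h]
        · rw [h, (hx i).2, hblockSum x₀ hx₀F i]
      rw [hFeq]
      refine ⟨⟨fun U => ?_, htight _ (isTight_univ hx₀)⟩, htight⟩
      exact sum_le_of_chain hf h0 (fun n hn => (hx ⟨n, hn⟩).1) k le_rfl U
        (hk ▸ Finset.subset_univ U)
end

section
/- Let f : P(E) → ℤ be a submodular function on a finite set E, let k be a positive integer, and let x be an integer vector lying in k·B_f (the set of points k·y with y ∈ B_f). Then there exist integer vectors x_1, …, x_k ∈ B_f ∩ ℤ^E such that x = x_1 + ⋯ + x_k. -/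
open Finset

/-- Submodularity restricted to the subsets of `S`. -/
def SubmodularWithin {E : Type*} [DecidableEq E] (S : Finset E) (f : Finset E → ℤ) : Prop :=
  f ∅ = 0 ∧ ∀ A ⊆ S, ∀ B ⊆ S, f (A ∪ B) + f (A ∩ B) ≤ f A + f B

/-- Projecting out an element `e` to which the value `t ≤ f {e}` is assigned keeps a set function
submodular. -/
theorem SubmodularWithin.project {E : Type*} [DecidableEq E] {S : Finset E} {e : E} (he : e ∉ S)
    {f : Finset E → ℤ} (hf : SubmodularWithin (insert e S) f) {t : ℤ} (ht : t ≤ f {e}) :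
    SubmodularWithin S (fun U => min (f U) (f (insert e U) - t)) := by
  refine ⟨by simpa [hf.1] using ht, fun A hA B hB => ?_⟩
  have hA' : A ⊆ insert e S := hA.trans (subset_insert e S)
  have hB' : B ⊆ insert e S := hB.trans (subset_insert e S)
  have hAe : insert e A ⊆ insert e S := insert_subset_insert e hA
  have hBe : insert e B ⊆ insert e S := insert_subset_insert e hB
  have h₁ := hf.2 A hA' B hB'
  have h₂ := hf.2 _ hAe B hB'
  have h₃ := hf.2 A hA' _ hBe
  have h₄ := hf.2 _ hAe _ hBe
  rw [insert_union, insert_inter_of_notMem fun h => he (hB h)] at h₂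
  rw [union_insert, inter_insert_of_notMem fun h => he (hA h)] at h₃
  rw [← insert_union_distrib, ← insert_inter_distrib] at h₄
  dsimp only
  omega

/-- Discrete sandwich theorem: between a supermodular function `-g` and a submodular function `f`
lies an integral modular function. -/
theorem SubmodularWithin.exists_modular_between {E : Type*} [DecidableEq E] (S : Finset E)
    (f g : Finset E → ℤ) (hf : SubmodularWithin S f) (hg : SubmodularWithin S g)
    (hfg : ∀ U ⊆ S, -g U ≤ f U) :
    ∃ z : E → ℤ, ∀ U ⊆ S, -g U ≤ ∑ e ∈ U, z e ∧ ∑ e ∈ U, z e ≤ f U := by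
  induction S using Finset.induction_on generalizing f g with
  | empty =>
    refine ⟨0, fun U hU => ?_⟩
    rw [subset_empty.mp hU]
    simp [hf.1, hg.1]
  | insert e S he ih =>
    obtain ⟨W, hW, hmax⟩ := exists_max_image S.powerset (fun V => -g (insert e V) - f V)
      ⟨∅, empty_mem_powerset S⟩
    simp only [mem_powerset] at hW hmax
    set t := -g (insert e W) - f W with ht
    have upper : ∀ U ⊆ S, t ≤ f (insert e U) + g U := by
      intro U hU
      have hU' : U ⊆ insert e S := hU.trans (subset_insert e S)
      have hW' : W ⊆ insert e S := hW.trans (subset_insert e S)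
      have h₁ := hf.2 _ (insert_subset_insert e hU) W hW'
      have h₂ := hg.2 _ (insert_subset_insert e hW) U hU'
      have h₃ := hfg _ (insert_subset_insert e (union_subset hU hW))
      have h₄ := hfg (U ∩ W) (inter_subset_left.trans hU')
      rw [insert_union, insert_inter_of_notMem fun h => he (hW h)] at h₁
      rw [insert_union, insert_inter_of_notMem fun h => he (hU h), union_comm W, inter_comm W]
        at h₂
      omega
    have hfe : t ≤ f {e} := by simpa [hg.1] using upper ∅ (empty_subset S)
    have hge : -t ≤ g {e} := by
      have := hmax ∅ (empty_subset S)
      simp only [insert_empty_eq, hf.1] at this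
      omega
    obtain ⟨z, hz⟩ := ih _ _ (hf.project he hfe) (hg.project he hge) (by
      intro U hU
      have h₁ := upper U hU
      have h₂ := hmax U hU
      have h₃ := hfg U (hU.trans (subset_insert e S))
      have h₄ := hfg _ (insert_subset_insert e hU)
      omega)
    have sum_update : ∀ U : Finset E, e ∉ U → ∑ a ∈ U, Function.update z e t a = ∑ a ∈ U, z a :=
      fun U hU => sum_update_of_notMem hU z t
    refine ⟨Function.update z e t, fun U hU => ?_⟩
    by_cases heU : e ∈ U
    · have h := hz (U.erase e) (subset_insert_iff.mp hU)
      rw [insert_erase heU] at h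
      rw [← add_sum_erase U _ heU, sum_update _ (notMem_erase e U), Function.update_self]
      omega
    · have h := hz U ((subset_insert_iff_of_notMem heU).mp hU)
      rw [sum_update U heU]
      omega

/-- An integral vector is in the base polytope iff it satisfies the defining constraints over
`ℤ`. -/
theorem intCast_mem_basePolytope {E : Type*} [Fintype E] (f : Finset E → ℤ) (x : E → ℤ) :
    (fun e => (x e : ℝ)) ∈ basePolytope f ↔
      (∀ U : Finset E, ∑ e ∈ U, x e ≤ f U) ∧ ∑ e, x e = f univ := by
  simp only [basePolytope, Set.mem_ofPred_eq]
  norm_cast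

/-- An integral vector satisfying the constraints of `k • B_f` is a sum of `k` integral vectors
of `B_f`. -/
theorem exists_sum_of_le_mul {E : Type*} [Fintype E] [DecidableEq E] (f : Finset E → ℤ)
    (hf : Submodular f) (k : ℕ) (x : E → ℤ) (hx : ∀ U : Finset E, ∑ e ∈ U, x e ≤ k * f U)
    (hxE : ∑ e, x e = k * f univ) :
    ∃ xs : Fin k → (E → ℤ),
      (∀ i, (fun e => ((xs i e : ℤ) : ℝ)) ∈ basePolytope f) ∧ x = ∑ i, xs i := by
  induction k generalizing x with
  | zero =>
    have hle : ∀ e ∈ univ, x e ≤ 0 := fun e _ => by simpa using hx {e}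
    have hzero := (sum_eq_zero_iff_of_nonpos hle).mp (by simpa using hxE)
    exact ⟨Fin.elim0, fun i => i.elim0, funext fun e => by simpa using hzero e (mem_univ e)⟩
  | succ k ih =>
    push_cast at hx hxE
    obtain ⟨z, hz⟩ := SubmodularWithin.exists_modular_between univ f
      (fun U => k * f U - ∑ e ∈ U, x e) ⟨hf.1, fun A _ B _ => hf.2 A B⟩
      ⟨by simp [hf.1], fun A _ B _ => by
        have h₁ := mul_le_mul_of_nonneg_left (hf.2 A B) (Int.natCast_nonneg k)
        have h₂ := sum_union_inter (s₁ := A) (s₂ := B) (f := x)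
        linarith⟩
      (fun U _ => by linarith [hx U])
    have hzE : ∑ e, z e = f univ := by
      have := hz univ (subset_univ _)
      linarith
    obtain ⟨xs, hxs, hsum⟩ := ih (x - z)
      (fun U => by
        have := (hz U (subset_univ U)).1
        simp only [Pi.sub_apply, sum_sub_distrib]
        linarith)
      (by
        simp only [Pi.sub_apply, sum_sub_distrib]
        linarith)
    refine ⟨Fin.cons z xs, fun i => ?_, by simp [Fin.sum_univ_succ, ← hsum]⟩
    refine Fin.cases ?_ hxs i
    exact (intCast_mem_basePolytope f z).mpr ⟨fun U => (hz U (subset_univ U)).2, hzE⟩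

/-- (Integer decomposition property.) If `x` is an integer vector lying in
`k · B_f` for a positive integer `k`, then `x = x₁ + ⋯ + x_k` for integer vectors
`x₁, …, x_k ∈ B_f ∩ ℤ^E`. -/
theorem basePolytope_integer_decomposition {E : Type*} [Fintype E] [DecidableEq E]
    (f : Finset E → ℤ) (hf : Submodular f) (k : ℕ) (hk : 0 < k) (x : E → ℤ)
    (hx : ∃ y ∈ basePolytope f, (fun e => (x e : ℝ)) = (k : ℝ) • y) :
    ∃ xs : Fin k → (E → ℤ),
      (∀ i, (fun e => ((xs i e : ℤ) : ℝ)) ∈ basePolytope f) ∧ x = ∑ i, xs i := by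
  obtain ⟨y, ⟨hy, hyE⟩, hxy⟩ := hx
  have hsum : ∀ U : Finset E, ((∑ e ∈ U, x e : ℤ) : ℝ) = k * ∑ e ∈ U, y e := by
    intro U
    push_cast
    rw [mul_sum]
    exact sum_congr rfl fun e _ => congrFun hxy e
  refine exists_sum_of_le_mul f hf k x (fun U => ?_) ?_
  · have h : ((∑ e ∈ U, x e : ℤ) : ℝ) ≤ k * f U := by
      rw [hsum]
      exact mul_le_mul_of_nonneg_left (hy U) k.cast_nonneg
    exact_mod_cast h
  · have h : ((∑ e, x e : ℤ) : ℝ) = k * f univ := by rw [hsum, hyE]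
    exact_mod_cast h
end

section
/- Let f, f' : P(E) → ℤ be submodular functions on a finite set E. Then B_f ∩ B_{f'} is an integer polytope: every vertex (extreme point) of B_f ∩ B_{f'} has all coordinates in ℤ. Equivalently, B_f ∩ B_{f'} is the convex hull of its integer points. -/
open Finset

/-- The atoms of a lattice of subsets containing `∅` and `univ`: there is a labelling of the ground
set whose fibers are differences of nested members, and that is finer than every member. -/
lemma exists_atom_labelling {E : Type*} [Fintype E] [DecidableEq E] (T : Finset E → Prop)
    (h_empty : T ∅) (h_univ : T univ) (h_union : ∀ A, T A → ∀ B, T B → T (A ∪ B))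
    (h_inter : ∀ A, T A → ∀ B, T B → T (A ∩ B)) :
    ∃ p : E → Finset E,
      (∀ e, ∃ A B, T A ∧ T B ∧ B ⊆ A ∧ univ.filter (fun y => p y = p e) = A \ B) ∧
      ∀ U, T U → ∀ y z, p y = p z → y ∈ U → z ∈ U := by
  classical
  let D : E → Finset E := fun e => (univ.filter fun U => T U ∧ e ∈ U).inf id
  have mem_D : ∀ e y, y ∈ D e ↔ ∀ U, T U → e ∈ U → y ∈ U := by
    intro e y
    simp [D, Finset.mem_inf]
  have D_T : ∀ e, T (D e) := by
    intro e
    refine Finset.inf_induction h_univ h_inter fun U hU => ?_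
    exact (Finset.mem_filter.1 hU).2.1
  have self_D : ∀ e, e ∈ D e := fun e => (mem_D e e).2 fun _ _ h => h
  have D_sub : ∀ e y, y ∈ D e → D y ⊆ D e := fun e y hy z hz =>
    (mem_D y z).1 hz _ (D_T e) hy
  refine ⟨D, fun e => ⟨D e, ((D e).filter fun z => e ∉ D z).sup D, D_T e, ?_, ?_, ?_⟩, ?_⟩
  · exact Finset.sup_induction h_empty h_union fun z _ => D_T z
  · exact Finset.sup_le fun z hz => D_sub e z (Finset.mem_filter.1 hz).1
  · ext y
    simp only [Finset.mem_filter, Finset.mem_univ, true_and, Finset.mem_sdiff, Finset.mem_sup,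
      not_exists, not_and]
    constructor
    · intro h
      refine ⟨h ▸ self_D y, fun z hz hy => hz.2 (D_sub z y hy (h ▸ self_D e))⟩
    · rintro ⟨hy, h⟩
      refine (D_sub e y hy).antisymm (D_sub y e ?_)
      by_contra hey
      exact h y ⟨hy, hey⟩ (self_D y)
  · intro U hU y z hyz hy
    exact (mem_D y z).1 (hyz ▸ self_D z) U hU hy

/-- The number of labels is at most half the number of points if every label is used twice. -/
lemma two_mul_card_range_le {ι α : Type*} [Fintype ι] [DecidableEq α] (p : ι → α)
    (hp : ∀ i, ∃ j, j ≠ i ∧ p j = p i) : 2 * Fintype.card (Set.range p) ≤ Fintype.card ι := by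
  classical
  have h := Finset.mul_card_image_le_card (f := p) (s := univ) 2 (by
    intro a ha
    obtain ⟨i, -, rfl⟩ := Finset.mem_image.1 ha
    obtain ⟨j, hj, hji⟩ := hp i
    exact Finset.one_lt_card.2 ⟨i, by simp, j, by simp [hji], hj.symm⟩)
  rwa [← Set.toFinset_range, Set.toFinset_card, Finset.card_univ] at h

/-- Given two partitions of a nonempty finite set without singleton parts, there is a nonzero vector
summing to zero on each part of both of them. -/
lemma exists_ne_zero_sum_fiber_eq_zero {ι α β : Type*} [Fintype ι] [Nonempty ι] [DecidableEq α]
    [DecidableEq β] (p : ι → α) (q : ι → β) (hp : ∀ i, ∃ j, j ≠ i ∧ p j = p i)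
    (hq : ∀ i, ∃ j, j ≠ i ∧ q j = q i) :
    ∃ d : ι → ℝ, d ≠ 0 ∧ (∀ a, ∑ i with p i = a, d i = 0) ∧ ∀ b, ∑ i with q i = b, d i = 0 := by
  classical
  let L : (ι → ℝ) →ₗ[ℝ] (Set.range p → ℝ) × (Set.range q → ℝ) :=
    { toFun := fun d => (fun a => ∑ i with p i = a, d i, fun b => ∑ i with q i = b, d i)
      map_add' := fun d d' => by ext <;> simp [Finset.sum_add_distrib]
      map_smul' := fun c d => by ext <;> simp [Finset.mul_sum] }
  have sum_fst : ∀ d, ∑ a, (L d).1 a = ∑ i, d i := fun d => by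
    have := Finset.sum_fiberwise univ (Set.rangeFactorization p) d
    simpa [L, Set.rangeFactorization, Subtype.ext_iff] using this
  have sum_snd : ∀ d, ∑ b, (L d).2 b = ∑ i, d i := fun d => by
    have := Finset.sum_fiberwise univ (Set.rangeFactorization q) d
    simpa [L, Set.rangeFactorization, Subtype.ext_iff] using this
  have h_not_inj : ¬ Function.Injective L := by
    intro h_inj
    have h_le := LinearMap.finrank_le_finrank_of_injective h_inj
    have h_card : Module.finrank ℝ (ι → ℝ) =
        Module.finrank ℝ ((Set.range p → ℝ) × (Set.range q → ℝ)) := by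
      have h1 := two_mul_card_range_le p hp
      have h2 := two_mul_card_range_le q hq
      simp only [Module.finrank_prod, Module.finrank_fintype_fun_eq_card] at h_le ⊢
      omega
    have h_surj := (LinearMap.injective_iff_surjective_of_finrank_eq_finrank h_card).1 h_inj
    obtain ⟨i⟩ := ‹Nonempty ι›
    obtain ⟨d, hd⟩ := h_surj (Pi.single ⟨p i, i, rfl⟩ 1, 0)
    have h := (sum_fst d).trans (sum_snd d).symm
    simp [hd] at h
  obtain ⟨d, hd, hd0⟩ : ∃ d, L d = 0 ∧ d ≠ 0 := by
    by_contra! h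
    exact h_not_inj ((injective_iff_map_eq_zero L).2 h)
  refine ⟨d, hd0, fun a => ?_, fun b => ?_⟩
  · by_cases ha : a ∈ Set.range p
    · exact congrFun (congrArg Prod.fst hd) ⟨a, ha⟩
    · refine Finset.sum_eq_zero fun i hi => (ha ⟨i, (Finset.mem_filter.1 hi).2⟩).elim
  · by_cases hb : b ∈ Set.range q
    · exact congrFun (congrArg Prod.snd hd) ⟨b, hb⟩
    · refine Finset.sum_eq_zero fun i hi => (hb ⟨i, (Finset.mem_filter.1 hi).2⟩).elim

/-- If a sum of reals is an integer, then it cannot have exactly one non-integer term. -/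
lemma exists_ne_notMem_int {E : Type*} [DecidableEq E] {K : Finset E} {x : E → ℝ} {e : E}
    (hK : ∃ n : ℤ, ∑ y ∈ K, x y = n) (he : e ∈ K) (hxe : ¬ ∃ n : ℤ, x e = n) :
    ∃ y ∈ K, y ≠ e ∧ ¬ ∃ n : ℤ, x y = n := by
  by_contra! h
  obtain ⟨n, hn⟩ := hK
  have hs : ∃ m : ℤ, ∑ y ∈ K.erase e, x y = m := by
    refine Finset.sum_induction x (fun r => ∃ m : ℤ, r = m) ?_ ⟨0, by simp⟩ fun y hy =>
      h y (Finset.mem_of_mem_erase hy) (Finset.ne_of_mem_erase hy)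
    rintro _ _ ⟨a, rfl⟩ ⟨b, rfl⟩
    exact ⟨a + b, by simp⟩
  obtain ⟨m, hm⟩ := hs
  have := Finset.add_sum_erase K x he
  exact hxe ⟨n - m, by push_cast; linarith⟩

/-- A labelling of the ground set by the atoms of the lattice of tight sets. -/
lemma exists_tight_labelling {E : Type*} [Fintype E] [DecidableEq E] {f : Finset E → ℤ}
    (hf : Submodular f) {x : E → ℝ} (hx : x ∈ basePolytope f) :
    ∃ p : E → Finset E, (∀ e, ∃ n : ℤ, ∑ y with p y = p e, x y = n) ∧
      ∀ U, ∑ e ∈ U, x e = (f U : ℝ) → ∀ y z, p y = p z → y ∈ U → z ∈ U := by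
  have h_lattice : ∀ A, ∑ e ∈ A, x e = (f A : ℝ) → ∀ B, ∑ e ∈ B, x e = (f B : ℝ) →
      ∑ e ∈ A ∪ B, x e = (f (A ∪ B) : ℝ) ∧ ∑ e ∈ A ∩ B, x e = (f (A ∩ B) : ℝ) := by
    intro A hA B hB
    have h1 := hx.1 (A ∪ B)
    have h2 := hx.1 (A ∩ B)
    have h3 : (f (A ∪ B) : ℝ) + f (A ∩ B) ≤ f A + f B := by exact_mod_cast hf.2 A B
    have h4 := Finset.sum_union_inter (s₁ := A) (s₂ := B) (f := x)
    constructor <;> linarith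
  obtain ⟨p, hp, hpU⟩ := exists_atom_labelling (fun U => ∑ e ∈ U, x e = (f U : ℝ))
    (by simp [hf.1]) hx.2 (fun A hA B hB => (h_lattice A hA B hB).1)
    fun A hA B hB => (h_lattice A hA B hB).2
  refine ⟨p, fun e => ?_, hpU⟩
  obtain ⟨A, B, hA, hB, hBA, h⟩ := hp e
  refine ⟨f A - f B, ?_⟩
  have := Finset.sum_sdiff hBA (f := x)
  rw [h]
  push_cast
  linarith

/-- A vector summing to zero on the fibers of a labelling sums to zero on unions of fibers. -/
lemma sum_eq_zero_of_sum_fiber_eq_zero {E α : Type*} [Fintype E] [DecidableEq E] [DecidableEq α]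
    {p : E → α} {d : E → ℝ} (hd : ∀ a, ∑ y with p y = a, d y = 0) {U : Finset E}
    (hU : ∀ y z, p y = p z → y ∈ U → z ∈ U) : ∑ e ∈ U, d e = 0 := by
  rw [← Finset.sum_fiberwise_of_maps_to (g := p) (t := U.image p)
    (fun e he => Finset.mem_image_of_mem p he)]
  refine Finset.sum_eq_zero fun a ha => ?_
  obtain ⟨u, hu, rfl⟩ := Finset.mem_image.1 ha
  rw [← hd (p u)]
  refine Finset.sum_congr ?_ fun _ _ => rfl
  ext y
  simpa using fun h => hU u y h.symm hu

/-- Small moves in a direction that vanishes on tight sets stay inside the base polytope. -/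
lemma eventually_add_smul_mem_basePolytope {E : Type*} [Fintype E]
    {f : Finset E → ℤ} {x d : E → ℝ} (hx : x ∈ basePolytope f)
    (hd : ∀ U, ∑ e ∈ U, x e = (f U : ℝ) → ∑ e ∈ U, d e = 0) :
    ∀ᶠ t : ℝ in nhds 0, x + t • d ∈ basePolytope f := by
  have h_sum : ∀ (t : ℝ) (U : Finset E),
      ∑ e ∈ U, (x + t • d) e = ∑ e ∈ U, x e + t * ∑ e ∈ U, d e := fun t U => by
    simp [Finset.sum_add_distrib, Finset.mul_sum]
  have h_ev : ∀ U : Finset E, ∀ᶠ t : ℝ in nhds 0, ∑ e ∈ U, (x + t • d) e ≤ (f U : ℝ) := by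
    intro U
    simp only [h_sum]
    rcases (hx.1 U).eq_or_lt with h | h
    · simp [hd U h, h]
    · have h_cont : Continuous fun t : ℝ => ∑ e ∈ U, x e + t * ∑ e ∈ U, d e := by fun_prop
      exact (h_cont.tendsto 0).eventually_le_const (by simpa using h)
  filter_upwards [Filter.eventually_all.2 h_ev] with t ht
  exact ⟨ht, by rw [h_sum, hd _ hx.2, hx.2]; simp⟩

/-- Extreme points of the intersection of two integral base polytopes are integral. -/
lemma isIntegerVec_of_mem_extremePoints {E : Type*} [Fintype E] [DecidableEq E]
    {f f' : Finset E → ℤ} (hf : Submodular f) (hf' : Submodular f') {x : E → ℝ}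
    (hx : x ∈ Set.extremePoints ℝ (basePolytope f ∩ basePolytope f')) : IsIntegerVec x := by
  classical
  by_contra h_int
  obtain ⟨e₀, he₀⟩ := not_forall.1 h_int
  obtain ⟨p, hp, hpU⟩ := exists_tight_labelling hf hx.1.1
  obtain ⟨q, hq, hqU⟩ := exists_tight_labelling hf' hx.1.2
  let F := {e : E // ¬ ∃ n : ℤ, x e = n}
  have : Nonempty F := ⟨⟨e₀, he₀⟩⟩
  have h_pair : ∀ r : E → Finset E, (∀ e, ∃ n : ℤ, ∑ y with r y = r e, x y = n) →
      ∀ i : F, ∃ j : F, j ≠ i ∧ r j = r i := by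
    intro r hr i
    obtain ⟨y, hy, hyi, hxy⟩ := exists_ne_notMem_int (hr i) (by simp) i.2
    exact ⟨⟨y, hxy⟩, fun h => hyi (congrArg Subtype.val h), (Finset.mem_filter.1 hy).2⟩
  obtain ⟨d, hd0, hdp, hdq⟩ := exists_ne_zero_sum_fiber_eq_zero (fun i : F => p i)
    (fun i : F => q i) (h_pair p hp) (h_pair q hq)
  let d' : E → ℝ := fun e => if h : ¬ ∃ n : ℤ, x e = n then d ⟨e, h⟩ else 0
  have h_val : ∀ i : F, d' i = d i := fun i => dif_pos i.2
  have h_fiber : ∀ (r : E → Finset E) (a : Finset E),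
      ∑ y with r y = a, d' y = ∑ i ∈ univ.filter (fun i : F => r i = a), d i := by
    intro r a
    rw [Finset.sum_filter, Finset.sum_filter]
    symm
    refine Fintype.sum_of_injective (Subtype.val : F → E) Subtype.val_injective _ _ ?_ ?_
    · intro e he
      have : d' e = 0 := dif_neg fun h => he ⟨⟨e, h⟩, rfl⟩
      simp [this]
    · intro i
      rw [h_val]
  have h_ev := eventually_add_smul_mem_basePolytope hx.1.1 (d := d') fun U hU =>
    sum_eq_zero_of_sum_fiber_eq_zero (fun a => (h_fiber p a).trans (hdp a)) (hpU U hU)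
  have h_ev' := eventually_add_smul_mem_basePolytope hx.1.2 (d := d') fun U hU =>
    sum_eq_zero_of_sum_fiber_eq_zero (fun a => (h_fiber q a).trans (hdq a)) (hqU U hU)
  obtain ⟨ε, hε, h_ball⟩ := Metric.eventually_nhds_iff.1 (h_ev.and h_ev')
  have h1 := h_ball (y := ε / 2) (by rw [Real.dist_eq, sub_zero, abs_of_pos] <;> linarith)
  have h2 := h_ball (y := -(ε / 2))
    (by rw [Real.dist_eq, sub_zero, abs_neg, abs_of_pos] <;> linarith)
  have h_eq := hx.2 h1 h2 ⟨1 / 2, 1 / 2, by norm_num, by norm_num, by norm_num, by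
    ext e
    simp only [Pi.add_apply, Pi.smul_apply, smul_eq_mul]
    ring⟩
  refine hd0 (funext fun i => ?_)
  have h := congrFun h_eq i
  simp only [Pi.add_apply, Pi.smul_apply, smul_eq_mul, h_val] at h
  have : ε / 2 * d i = 0 := by linarith
  exact (mul_eq_zero.1 this).resolve_left (by positivity)

/-- The base polytope lies in a box with integral corners. -/
lemma basePolytope_subset_Icc {E : Type*} [Fintype E] [DecidableEq E] (f : Finset E → ℤ) :
    basePolytope f ⊆ Set.Icc (fun e => ((f univ - f (univ.erase e) : ℤ) : ℝ))
      fun e => ((f {e} : ℤ) : ℝ) := by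
  refine fun x hx => ⟨fun e => ?_, fun e => by simpa using hx.1 {e}⟩
  have h1 := hx.1 (univ.erase e)
  have h2 := Finset.add_sum_erase univ x (Finset.mem_univ e)
  have h3 := hx.2
  push_cast
  linarith

lemma isClosed_basePolytope {E : Type*} [Fintype E] (f : Finset E → ℤ) :
    IsClosed (basePolytope f) := by
  simp only [basePolytope, Set.ofPred_and, Set.ofPred_forall]
  refine (isClosed_iInter fun U => isClosed_le ?_ ?_).inter (isClosed_eq ?_ ?_) <;> fun_prop

lemma convex_basePolytope {E : Type*} [Fintype E] (f : Finset E → ℤ) :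
    Convex ℝ (basePolytope f) := by
  have h_sum : ∀ (U : Finset E) (x y : E → ℝ) (a b : ℝ),
      ∑ e ∈ U, (a • x + b • y) e = a * ∑ e ∈ U, x e + b * ∑ e ∈ U, y e := by
    intro U x y a b
    simp [Finset.sum_add_distrib, Finset.mul_sum]
  intro x hx y hy a b ha hb hab
  refine ⟨fun U => ?_, ?_⟩
  · rw [h_sum]
    calc a * ∑ e ∈ U, x e + b * ∑ e ∈ U, y e ≤ a * f U + b * f U := by
          gcongr
          exacts [hx.1 U, hy.1 U]
      _ = f U := by rw [← add_mul, hab, one_mul]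
  · rw [h_sum, hx.2, hy.2, ← add_mul, hab, one_mul]

/-- A box with integral corners contains finitely many integral points. -/
lemma finite_isIntegerVec_Icc {E : Type*} [Fintype E] [DecidableEq E] (a b : E → ℤ) :
    {x ∈ Set.Icc (fun e => (a e : ℝ)) (fun e => (b e : ℝ)) | IsIntegerVec x}.Finite := by
  refine ((Set.finite_Icc a b).image fun (n : E → ℤ) e => (n e : ℝ)).subset ?_
  rintro x ⟨⟨hax, hxb⟩, hx⟩
  choose n hn using hx
  obtain rfl : x = fun e => (n e : ℝ) := funext hn
  exact ⟨n, ⟨fun e => Int.cast_le.1 (hax e), fun e => Int.cast_le.1 (hxb e)⟩, rfl⟩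

/-- (Polymatroid intersection theorem.) For submodular `f, f'`, the polytope
`B_f ∩ B_{f'}` is an integer polytope: all its extreme points are integral, and it is the
convex hull of its integer points. -/
theorem basePolytope_inter_integral {E : Type*} [Fintype E] [DecidableEq E]
    (f f' : Finset E → ℤ) (hf : Submodular f) (hf' : Submodular f') :
    (∀ x ∈ Set.extremePoints ℝ (basePolytope f ∩ basePolytope f'), IsIntegerVec x) ∧
    basePolytope f ∩ basePolytope f' =
      convexHull ℝ {x ∈ basePolytope f ∩ basePolytope f' | IsIntegerVec x} := by
  have h_ext : ∀ x ∈ Set.extremePoints ℝ (basePolytope f ∩ basePolytope f'), IsIntegerVec x :=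
    fun x hx => isIntegerVec_of_mem_extremePoints hf hf' hx
  have h_convex := (convex_basePolytope f).inter (convex_basePolytope f')
  have h_compact : IsCompact (basePolytope f ∩ basePolytope f') :=
    isCompact_Icc.of_isClosed_subset
      ((isClosed_basePolytope f).inter (isClosed_basePolytope f'))
      (Set.inter_subset_left.trans (basePolytope_subset_Icc f))
  have h_finite : {x ∈ basePolytope f ∩ basePolytope f' | IsIntegerVec x}.Finite :=
    (finite_isIntegerVec_Icc _ _).subset fun x hx => ⟨basePolytope_subset_Icc f hx.1.1, hx.2⟩
  refine ⟨h_ext, Set.Subset.antisymm ?_ (convexHull_min (fun x hx => hx.1) h_convex)⟩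
  refine (closure_convexHull_extremePoints h_compact h_convex).symm.subset.trans
    (closure_minimal (convexHull_mono fun x hx => ⟨hx.1, h_ext x hx⟩) ?_)
  exact h_finite.isClosed_convexHull ℝ
end

section
/- Let f : P(E) → ℤ be a submodular function on a finite set E and let a : E → ℤ. Define the reduction f|a by (f|a)(U) := min over T ⊆ U of (f(T) + a(U \ T)), where a(S) = Σ_{e∈S} a(e). Then f|a is submodular and its extended polymatroid satisfies EP_{f|a} = {x ∈ EP_f : x(e) ≤ a(e) for all e ∈ E}. -/
open Finset

/-- The extended polymatroid `EP_f = {x : x(U) ≤ f(U) for all U ⊆ E}`. -/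
def extPolymatroid {E : Type*} [Fintype E] (f : Finset E → ℤ) : Set (E → ℝ) :=
  {x | ∀ U : Finset E, ∑ e ∈ U, x e ≤ (f U : ℝ)}

/-- The reduction `f|a` of `f` by `a`: `(f|a)(U) = min_{T ⊆ U} (f(T) + a(U \ T))`. -/
def reduction {E : Type*} [DecidableEq E] (f : Finset E → ℤ) (a : E → ℤ) :
    Finset E → ℤ := fun U =>
  (U.powerset.image (fun T => f T + ∑ e ∈ U \ T, a e)).min'
    ((U.powerset_nonempty).image _)

theorem reduction_le {E : Type*} [DecidableEq E] (f : Finset E → ℤ) (a : E → ℤ)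
    {T U : Finset E} (h : T ⊆ U) : reduction f a U ≤ f T + ∑ e ∈ U \ T, a e :=
  Finset.min'_le _ _ (mem_image_of_mem _ (mem_powerset.2 h))

theorem exists_reduction_eq {E : Type*} [DecidableEq E] (f : Finset E → ℤ) (a : E → ℤ)
    (U : Finset E) : ∃ T ⊆ U, reduction f a U = f T + ∑ e ∈ U \ T, a e := by
  obtain ⟨T, hT, h⟩ := mem_image.1 (Finset.min'_mem
    (U.powerset.image (fun T => f T + ∑ e ∈ U \ T, a e)) ((U.powerset_nonempty).image _))
  exact ⟨T, mem_powerset.1 hT, h.symm⟩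

theorem Submodular.reduction {E : Type*} [DecidableEq E] {f : Finset E → ℤ}
    (hf : Submodular f) (a : E → ℤ) : Submodular (reduction f a) := by
  refine ⟨?_, fun A B => ?_⟩
  · obtain ⟨T, hT, h⟩ := exists_reduction_eq f a ∅
    rw [h, subset_empty.1 hT]
    simp [hf.1]
  · obtain ⟨S, hS, hA⟩ := exists_reduction_eq f a A
    obtain ⟨T, hT, hB⟩ := exists_reduction_eq f a B
    have hU := reduction_le f a (union_subset_union hS hT)
    have hI := reduction_le f a (inter_subset_inter hS hT)
    have hST := hf.2 S T
    rw [sum_sdiff_eq_sub hS] at hA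
    rw [sum_sdiff_eq_sub hT] at hB
    rw [sum_sdiff_eq_sub (union_subset_union hS hT)] at hU
    rw [sum_sdiff_eq_sub (inter_subset_inter hS hT)] at hI
    have hAB := sum_union_inter (s₁ := A) (s₂ := B) (f := a)
    have hST' := sum_union_inter (s₁ := S) (s₂ := T) (f := a)
    linarith

theorem extPolymatroid_reduction {E : Type*} [Fintype E] [DecidableEq E]
    {f : Finset E → ℤ} (hf : f ∅ = 0) (a : E → ℤ) :
    extPolymatroid (reduction f a) = {x ∈ extPolymatroid f | ∀ e, x e ≤ (a e : ℝ)} := by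
  ext x
  constructor
  · refine fun hx => ⟨fun U => (hx U).trans ?_, fun e => ?_⟩
    · exact_mod_cast (reduction_le f a (Subset.refl U)).trans_eq (by simp)
    · have h : reduction f a {e} ≤ a e :=
        (reduction_le f a (empty_subset {e})).trans_eq (by simp [hf])
      have hxe := hx {e}
      rw [sum_singleton] at hxe
      exact hxe.trans (by exact_mod_cast h)
  · rintro ⟨hx, hxa⟩ U
    obtain ⟨T, hT, h⟩ := exists_reduction_eq f a U
    rw [h, ← sum_sdiff hT, add_comm]
    push_cast
    exact add_le_add (hx T) (sum_le_sum fun e _ => hxa e)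

/-- The reduction `f|a` is submodular and
`EP_{f|a} = {x ∈ EP_f : x ≤ a}`. -/
theorem reduction_submodular {E : Type*} [Fintype E] [DecidableEq E]
    (f : Finset E → ℤ) (hf : Submodular f) (a : E → ℤ) :
    Submodular (reduction f a) ∧
    extPolymatroid (reduction f a) =
      {x ∈ extPolymatroid f | ∀ e, x e ≤ (a e : ℝ)} :=
  ⟨hf.reduction a, extPolymatroid_reduction hf.1 a⟩
end

section
/- Let f : P(E) → ℤ be a submodular function on a finite set E and let a : E → ℤ, with reduction (f|a)(U) := min over T ⊆ U of (f(T) + a(U \ T)). If the set {x ∈ B_f : x(e) ≤ a(e) for all e ∈ E} is nonempty, then B_{f|a} = {x ∈ B_f : x(e) ≤ a(e) for all e ∈ E}. -/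
open Finset

theorem reduction_le_self {E : Type*} [DecidableEq E] (f : Finset E → ℤ) (a : E → ℤ)
    (U : Finset E) : reduction f a U ≤ f U := by
  simpa using reduction_le f a (Finset.Subset.refl U)

theorem reduction_singleton_le {E : Type*} [DecidableEq E] {f : Finset E → ℤ}
    (hf : f ∅ = 0) (a : E → ℤ) (e : E) : reduction f a {e} ≤ a e := by
  simpa [hf] using reduction_le f a (Finset.empty_subset {e})

/-- A vector of the extended polymatroid of `f` lying below `a` satisfies the constraints of
the reduction of `f` by `a`. -/
theorem sum_le_reduction {E : Type*} [Fintype E] [DecidableEq E] {f : Finset E → ℤ}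
    {a : E → ℤ} {x : E → ℝ} (hx : x ∈ extPolymatroid f) (hxa : ∀ e, x e ≤ a e)
    (U : Finset E) : ∑ e ∈ U, x e ≤ (reduction f a U : ℝ) := by
  obtain ⟨T, hT, h⟩ := exists_reduction_eq f a U
  rw [h, ← Finset.sum_sdiff hT, add_comm]
  push_cast
  exact add_le_add (hx T) (Finset.sum_le_sum fun e _ => hxa e)

/-- If `B_f` has a point below `a`, then reducing `f` by `a` does not change its value on the
ground set. -/
theorem reduction_univ {E : Type*} [Fintype E] [DecidableEq E] {f : Finset E → ℤ}
    {a : E → ℤ} (hne : {x ∈ basePolytope f | ∀ e, x e ≤ (a e : ℝ)}.Nonempty) :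
    reduction f a Finset.univ = f Finset.univ := by
  obtain ⟨x, ⟨hx, hsum⟩, hxa⟩ := hne
  refine le_antisymm (reduction_le_self f a _) ?_
  have h := sum_le_reduction hx hxa Finset.univ
  rw [hsum] at h
  exact_mod_cast h

/-- If `{x ∈ B_f : x ≤ a}` is nonempty, then
`B_{f|a} = {x ∈ B_f : x ≤ a}`. -/
theorem basePolytope_reduction {E : Type*} [Fintype E] [DecidableEq E]
    (f : Finset E → ℤ) (hf : Submodular f) (a : E → ℤ)
    (hne : {x ∈ basePolytope f | ∀ e, x e ≤ (a e : ℝ)}.Nonempty) :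
    basePolytope (reduction f a) = {x ∈ basePolytope f | ∀ e, x e ≤ (a e : ℝ)} := by
  ext x
  constructor
  · rintro ⟨hx, hsum⟩
    refine ⟨⟨fun U => (hx U).trans (mod_cast reduction_le_self f a U), ?_⟩, fun e => ?_⟩
    · rw [hsum, reduction_univ hne]
    · have h := hx {e}
      rw [Finset.sum_singleton] at h
      exact h.trans (mod_cast reduction_singleton_le hf.1 a e)
  · rintro ⟨⟨hx, hsum⟩, hxa⟩
    exact ⟨sum_le_reduction hx hxa, by rw [hsum, reduction_univ hne]⟩
end

section
/- Let E be a finite set and let T ⊆ P(E) be a family of subsets of E that contains ∅ and E and is closed under unions and intersections. Suppose the linear span of the characteristic vectors {χ^A : A ∈ T} in ℝ^E has dimension t. Then every maximal chain ∅ = A_0 ⊂ A_1 ⊂ ⋯ ⊂ A_{t'} = E of sets in T (maximal with respect to refinement inside T) has length t' = t, and the characteristic vectors χ^{A_1}, …, χ^{A_t} form a basis of that span. -/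
open Finset

/-- The characteristic vector of a finite set. -/
def charVec {E : Type*} [DecidableEq E] (A : Finset E) : E → ℝ :=
  fun e => if e ∈ A then 1 else 0

theorem charVec_empty {E : Type*} [DecidableEq E] : charVec (∅ : Finset E) = 0 := by
  funext e
  simp [charVec]

/-- Modularity of characteristic vectors. -/
theorem charVec_union_add_charVec_inter {E : Type*} [DecidableEq E] (A B : Finset E) :
    charVec (A ∪ B) + charVec (A ∩ B) = charVec A + charVec B := by
  funext e
  by_cases hA : e ∈ A <;> by_cases hB : e ∈ B <;> simp [charVec, hA, hB]

/-- The characteristic vectors of the successors in a strictly increasing chain of finite sets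
are linearly independent. -/
theorem linearIndependent_charVec_succ {E : Type*} [DecidableEq E] {n : ℕ}
    {A : Fin (n + 1) → Finset E} (hmono : StrictMono A) :
    LinearIndependent ℝ (fun i : Fin n => charVec (A i.succ)) := by
  rw [Fintype.linearIndependent_iff]
  intro c hc
  by_contra! hne
  obtain ⟨i, hi, himax⟩ := ({i | c i ≠ 0} : Set (Fin n)).toFinite.exists_maximal hne
  obtain ⟨e, he, he'⟩ := Finset.exists_of_ssubset (hmono i.castSucc_lt_succ)
  have hsum := congrFun hc e
  rw [Finset.sum_apply, Finset.sum_eq_single i] at hsum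
  · exact hi (by simpa [charVec, he] using hsum)
  · intro j _ hji
    rcases lt_or_gt_of_ne hji with h | h
    · have hsub : A j.succ ⊆ A i.castSucc :=
        hmono.monotone (Fin.succ_le_castSucc_iff.mpr h)
      have hej : e ∉ A j.succ := fun hej => he' (hsub hej)
      simp [charVec, hej]
    · have hcj : c j = 0 := by
        by_contra hcj
        exact absurd (himax hcj h.le) (not_le_of_gt h)
      simp [hcj]
  · simp

/-- In a lattice family, the characteristic vectors of a maximal chain from `∅` to the whole
ground set span the characteristic vectors of all members. -/
theorem charVec_mem_span_of_maximal_chain {E : Type*} [Fintype E] [DecidableEq E]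
    {T : Set (Finset E)}
    (hU : ∀ A ∈ T, ∀ B ∈ T, A ∪ B ∈ T) (hI : ∀ A ∈ T, ∀ B ∈ T, A ∩ B ∈ T)
    {n : ℕ} {A : Fin (n + 1) → Finset E} (hmem : ∀ i, A i ∈ T) (hmono : StrictMono A)
    (hfirst : A 0 = ∅) (hlast : A (Fin.last n) = Finset.univ)
    (hmax : ∀ i : Fin n, ∀ B ∈ T, A i.castSucc ⊆ B → B ⊆ A i.succ →
      B = A i.castSucc ∨ B = A i.succ) {B : Finset E} (hB : B ∈ T) :
    charVec B ∈ Submodule.span ℝ (Set.range (fun i : Fin n => charVec (A i.succ))) := by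
  set S := Submodule.span ℝ (Set.range (fun i : Fin n => charVec (A i.succ)))
  have hA : ∀ i, charVec (A i) ∈ S := by
    intro i
    cases i using Fin.cases with
    | zero => simp [hfirst, charVec_empty]
    | succ i => exact Submodule.subset_span ⟨i, rfl⟩
  have key : ∀ i, charVec (B ∩ A i) ∈ S := by
    intro i
    induction i using Fin.induction with
    | zero => simp [hfirst, charVec_empty]
    | succ i ih =>
      have hsub : A i.castSucc ⊆ A i.succ := hmono.monotone i.castSucc_lt_succ.le
      have hinter : A i.castSucc ∩ (B ∩ A i.succ) = B ∩ A i.castSucc := by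
        rw [Finset.inter_left_comm, Finset.inter_eq_left.mpr hsub]
      have hmod := charVec_union_add_charVec_inter (A i.castSucc) (B ∩ A i.succ)
      rw [hinter] at hmod
      have hunion : charVec (A i.castSucc ∪ (B ∩ A i.succ)) ∈ S := by
        rcases hmax i _ (hU _ (hmem _) _ (hI _ hB _ (hmem _))) Finset.subset_union_left
          (Finset.union_subset hsub Finset.inter_subset_right) with h | h <;>
        · rw [h]
          exact hA _
      rw [eq_sub_of_add_eq' hmod.symm]
      exact S.sub_mem (S.add_mem hunion ih) (hA _)
  simpa [hlast] using key (Fin.last n)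

/-- Let `T ⊆ P(E)` contain `∅` and `E` and be closed under unions and
intersections, and suppose the span of the characteristic vectors of members of `T` has
dimension `t`. Then every maximal chain `∅ = A₀ ⊂ A₁ ⊂ ⋯ ⊂ A_{t'} = E` in `T` has
`t' = t`, and `χ^{A₁}, …, χ^{A_t}` form a basis of that span. -/
theorem maximal_chain_in_lattice_family {E : Type*} [Fintype E] [DecidableEq E]
    (T : Set (Finset E)) (h0 : ∅ ∈ T) (h1 : Finset.univ ∈ T)
    (hU : ∀ A ∈ T, ∀ B ∈ T, A ∪ B ∈ T) (hI : ∀ A ∈ T, ∀ B ∈ T, A ∩ B ∈ T)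
    (t : ℕ) (ht : Module.finrank ℝ (Submodule.span ℝ (charVec '' T)) = t)
    (t' : ℕ) (A : Fin (t' + 1) → Finset E)
    (hmem : ∀ i, A i ∈ T) (hmono : StrictMono A)
    (hfirst : A 0 = ∅) (hlast : A (Fin.last t') = Finset.univ)
    (hmax : ∀ i : Fin t', ∀ B ∈ T, A i.castSucc ⊆ B → B ⊆ A i.succ →
      B = A i.castSucc ∨ B = A i.succ) :
    t' = t ∧
    LinearIndependent ℝ (fun i : Fin t' => charVec (A i.succ)) ∧
    Submodule.span ℝ (Set.range (fun i : Fin t' => charVec (A i.succ))) =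
      Submodule.span ℝ (charVec '' T) := by
  have hind := linearIndependent_charVec_succ hmono
  have hspan : Submodule.span ℝ (Set.range (fun i : Fin t' => charVec (A i.succ))) =
      Submodule.span ℝ (charVec '' T) := by
    apply le_antisymm
    · apply Submodule.span_mono
      rintro _ ⟨i, rfl⟩
      exact ⟨_, hmem _, rfl⟩
    · rw [Submodule.span_le]
      rintro _ ⟨B, hB, rfl⟩
      exact charVec_mem_span_of_maximal_chain hU hI hmem hmono hfirst hlast hmax hB
  refine ⟨?_, hind, hspan⟩
  rw [← ht, ← hspan, finrank_span_eq_card hind, Fintype.card_fin]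
end

section
/- Let P and Q be polytopes in ℝ^n and let x be a vertex (extreme point) of P ∩ Q with x ∈ P and x ∈ Q. Let F_P be the inclusionwise minimal face of P containing x and F_Q the inclusionwise minimal face of Q containing x. Then the affine hulls of F_P and F_Q intersect exactly in {x}. -/
open Finset

open Topology in
/-- A convex set absorbs every direction of its affine span at a point `x` of it, provided that
every linear functional which is maximized over the set at `x` is constant on the set. -/
theorem Convex.eventually_add_smul_sub_mem {V : Type*} [NormedAddCommGroup V] [NormedSpace ℝ V]
    [FiniteDimensional ℝ V] {F : Set V} (hF : Convex ℝ F) {x y : V} (hx : x ∈ F)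
    (hconst : ∀ f : Module.Dual ℝ V, (∀ a ∈ F, f a ≤ f x) → ∀ a ∈ F, f a = f x)
    (hy : y ∈ affineSpan ℝ F) : ∀ᶠ ε : ℝ in 𝓝 0, x + ε • (y - x) ∈ F := by
  set L := vectorSpan ℝ F with hL
  let S : Set L := {l | x + (l : V) ∈ F}
  have hmem : ∀ a ∈ F, a - x ∈ L := fun a ha => vsub_mem_vectorSpan ℝ ha hx
  have hS0 : (0 : L) ∈ S := by simpa [S] using hx
  have hSconv : Convex ℝ S := by
    have h := (hF.translate_preimage_right x).linear_preimage L.subtype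
    exact h
  have hSspan : affineSpan ℝ S = ⊤ := by
    rw [AffineSubspace.affineSpan_eq_top_iff_vectorSpan_eq_top_of_nonempty ℝ L L ⟨0, hS0⟩,
      vectorSpan_eq_span_vsub_set_right ℝ hS0]
    have himage : ((fun l : L => l -ᵥ (0 : L)) '' S) =
        Subtype.val ⁻¹' ((fun a => a -ᵥ x) '' F) := by
      ext l
      constructor
      · rintro ⟨m, hm, rfl⟩
        exact ⟨x + m, hm, by simp⟩
      · rintro ⟨a, ha, hal⟩
        exact ⟨l, by simpa [S, ← hal] using ha, by simp⟩
    rw [himage]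
    have hspan := vectorSpan_eq_span_vsub_set_right ℝ hx
    rw [← hL] at hspan
    apply Submodule.map_injective_of_injective L.subtype_injective
    rw [Submodule.map_span, Submodule.map_subtype_top]
    rw [Submodule.coe_subtype, Set.image_preimage_eq_of_subset, ← hspan]
    rintro _ ⟨a, ha, rfl⟩
    exact ⟨⟨a - x, hmem a ha⟩, rfl⟩
  have hint : (0 : L) ∈ interior S := by
    by_contra h0
    obtain ⟨f, hf0, hf⟩ := geometric_hahn_banach_of_nonempty_interior_point hSconv h0
      (hSconv.interior_nonempty_iff_affineSpan_eq_top.2 hSspan)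
    obtain ⟨g, hg⟩ := (f : L →ₗ[ℝ] ℝ).exists_extend
    have hgf : ∀ l : L, g l = f l := fun l => LinearMap.congr_fun hg l
    have hgx : ∀ a ∈ F, g a = g x := by
      refine hconst g fun a ha => ?_
      have h := hf ⟨a - x, hmem a ha⟩ (by simpa [S] using ha)
      rw [← hgf, map_zero, map_sub] at h
      linarith
    have hLg : L ≤ LinearMap.ker g := by
      rw [hL, vectorSpan_eq_span_vsub_set_right ℝ hx, Submodule.span_le]
      rintro _ ⟨a, ha, rfl⟩
      simp [hgx a ha]
    exact hf0 (ContinuousLinearMap.ext fun l => (hgf l).symm.trans (hLg l.2))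
  have hyL : y - x ∈ L := by
    rw [hL, ← direction_affineSpan]
    exact AffineSubspace.vsub_mem_direction hy (mem_affineSpan ℝ hx)
  have hcont : Filter.Tendsto (fun ε : ℝ => ε • (⟨y - x, hyL⟩ : L)) (𝓝 0) (𝓝 0) := by
    have h : Continuous fun ε : ℝ => ε • (⟨y - x, hyL⟩ : L) := by fun_prop
    simpa using h.tendsto 0
  exact hcont.eventually (mem_interior_iff_mem_nhds.1 hint)

theorem isFaceOf_iff_exists_dual {E : Type*} [Fintype E] {P F : Set (E → ℝ)} :
    IsFaceOf P F ↔ ∃ f : Module.Dual ℝ (E → ℝ), F = {x ∈ P | ∀ y ∈ P, f y ≤ f x} := by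
  classical
  constructor
  · rintro ⟨c, h⟩
    exact ⟨dotProductEquiv ℝ E c, h⟩
  · rintro ⟨f, h⟩
    obtain ⟨c, rfl⟩ := (dotProductEquiv ℝ E).surjective f
    exact ⟨c, h⟩

theorem IsFaceOf.subset {E : Type*} [Fintype E] {P F : Set (E → ℝ)} (h : IsFaceOf P F) :
    F ⊆ P := by
  obtain ⟨c, rfl⟩ := h
  exact Set.sep_subset _ _

theorem IsFaceOf.convex {E : Type*} [Fintype E] {P F : Set (E → ℝ)} (h : IsFaceOf P F)
    (hP : Convex ℝ P) : Convex ℝ F := by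
  obtain ⟨f, rfl⟩ := isFaceOf_iff_exists_dual.1 h
  intro a ha b hb s t hs ht hst
  refine ⟨hP ha.1 hb.1 hs ht hst, fun y hy => ?_⟩
  have h1 := mul_le_mul_of_nonneg_left (ha.2 y hy) hs
  have h2 := mul_le_mul_of_nonneg_left (hb.2 y hy) ht
  have h3 : f y = s * f y + t * f y := by rw [← add_mul, hst, one_mul]
  simp only [map_add, map_smul, smul_eq_mul]
  linarith

open Topology in
/-- A linear functional maximized over the minimal face of a polytope containing `x` at `x` is
constant on that face. -/
theorem IsFaceOf.dual_eq_of_minimal {E : Type*} [Fintype E] {V : Finset (E → ℝ)}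
    {F : Set (E → ℝ)} {x : E → ℝ} (hF : IsFaceOf (convexHull ℝ (V : Set (E → ℝ))) F) (hx : x ∈ F)
    (hmin : ∀ G, IsFaceOf (convexHull ℝ (V : Set (E → ℝ))) G → x ∈ G → F ⊆ G)
    (f : Module.Dual ℝ (E → ℝ)) (hf : ∀ a ∈ F, f a ≤ f x) : ∀ a ∈ F, f a = f x := by
  obtain ⟨g, rfl⟩ := isFaceOf_iff_exists_dual.1 hF
  have hpert : ∀ᶠ δ : ℝ in 𝓝[>] 0, ∀ v ∈ V, (g + δ • f) v ≤ (g + δ • f) x := by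
    rw [Filter.eventually_all_finset]
    intro v hv
    have hvP : v ∈ convexHull ℝ (V : Set (E → ℝ)) := subset_convexHull ℝ _ hv
    rcases (hx.2 v hvP).lt_or_eq with hlt | heq
    · have hc : ∀ z, Continuous fun δ : ℝ => (g + δ • f) z := fun z => by
        simp only [LinearMap.add_apply, LinearMap.smul_apply]
        fun_prop
      have h : ∀ᶠ δ : ℝ in 𝓝 0, (g + δ • f) v < (g + δ • f) x :=
        (hc v).continuousAt.eventually_lt (hc x).continuousAt (by simpa using hlt)
      exact (h.filter_mono nhdsWithin_le_nhds).mono fun _ h => h.le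
    · filter_upwards [self_mem_nhdsWithin] with δ hδ
      have h := mul_le_mul_of_nonneg_left
        (hf v ⟨hvP, fun y hy => heq ▸ hx.2 y hy⟩) (Set.mem_Ioi.1 hδ).le
      simpa [heq] using h
  obtain ⟨δ, hδV, hδ⟩ := (hpert.and self_mem_nhdsWithin).exists
  have hle : ∀ y ∈ convexHull ℝ (V : Set (E → ℝ)), (g + δ • f) y ≤ (g + δ • f) x :=
    convexHull_min hδV (convex_halfSpace_le (g + δ • f).isLinear _)
  intro a ha
  refine (hf a ha).antisymm ?_
  have h1 := (hmin _ (isFaceOf_iff_exists_dual.2 ⟨g + δ • f, rfl⟩) ⟨hx.1, hle⟩ ha).2 x hx.1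
  have h2 := hx.2 a ha.1
  simp only [LinearMap.add_apply, LinearMap.smul_apply, smul_eq_mul] at h1
  exact le_of_mul_le_mul_left (by linarith) (Set.mem_Ioi.1 hδ)

open Topology in
theorem IsFaceOf.eventually_add_smul_sub_mem {E : Type*} [Fintype E] {V : Finset (E → ℝ)}
    {F : Set (E → ℝ)} {x y : E → ℝ} (hF : IsFaceOf (convexHull ℝ (V : Set (E → ℝ))) F)
    (hx : x ∈ F) (hmin : ∀ G, IsFaceOf (convexHull ℝ (V : Set (E → ℝ))) G → x ∈ G → F ⊆ G)
    (hy : y ∈ affineSpan ℝ F) :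
    ∀ᶠ ε : ℝ in 𝓝 0, x + ε • (y - x) ∈ convexHull ℝ (V : Set (E → ℝ)) :=
  ((hF.convex (convex_convexHull ℝ _)).eventually_add_smul_sub_mem hx
    (hF.dual_eq_of_minimal hx hmin) hy).mono fun _ h => hF.subset h

/-- Let `P, Q` be polytopes in `ℝⁿ` and `x` a vertex of `P ∩ Q`. If `F_P`
and `F_Q` are the inclusionwise minimal faces of `P` resp. `Q` containing `x`, then the
affine hulls of `F_P` and `F_Q` intersect exactly in `{x}`. -/
theorem minimal_faces_affineSpan_inter {n : ℕ} (P Q : Set (Fin n → ℝ))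
    (VP VQ : Finset (Fin n → ℝ))
    (hP : P = convexHull ℝ (VP : Set (Fin n → ℝ)))
    (hQ : Q = convexHull ℝ (VQ : Set (Fin n → ℝ)))
    (x : Fin n → ℝ) (hx : x ∈ Set.extremePoints ℝ (P ∩ Q))
    (FP FQ : Set (Fin n → ℝ))
    (hFP : IsFaceOf P FP) (hxP : x ∈ FP)
    (hFPmin : ∀ F, IsFaceOf P F → x ∈ F → FP ⊆ F)
    (hFQ : IsFaceOf Q FQ) (hxQ : x ∈ FQ)
    (hFQmin : ∀ F, IsFaceOf Q F → x ∈ F → FQ ⊆ F) :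
    (affineSpan ℝ FP : Set (Fin n → ℝ)) ∩ (affineSpan ℝ FQ : Set (Fin n → ℝ)) = {x} := by
  subst hP hQ
  refine Set.Subset.antisymm ?_
    (Set.singleton_subset_iff.2 ⟨mem_affineSpan ℝ hxP, mem_affineSpan ℝ hxQ⟩)
  rintro y ⟨hyP, hyQ⟩
  have hev := (hFP.eventually_add_smul_sub_mem hxP hFPmin hyP).and
    (hFQ.eventually_add_smul_sub_mem hxQ hFQmin hyQ)
  obtain ⟨r, hr, hball⟩ := Metric.eventually_nhds_iff.1 hev
  have hpos := @hball (r / 2)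
    (by rw [Real.dist_eq, sub_zero, abs_of_pos (half_pos hr)]; linarith)
  have hneg := @hball (-(r / 2))
    (by rw [Real.dist_eq, sub_zero, abs_neg, abs_of_pos (half_pos hr)]; linarith)
  have hseg : x ∈ openSegment ℝ (x + (r / 2) • (y - x)) (x + (-(r / 2)) • (y - x)) :=
    ⟨1 / 2, 1 / 2, by norm_num, by norm_num, by norm_num, by module⟩
  have h := hx.2 hpos hneg hseg
  have hsmul : (r / 2) • (y - x) = 0 := by simpa using h
  exact sub_eq_zero.1 ((smul_eq_zero.1 hsmul).resolve_left (by positivity))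
end

section
/- Let f : P(E) → ℤ be a submodular function on a finite set E with B_f nonempty, and let w be a nonnegative integer combination of integer points of B_f, say w ∈ k·B_f ∩ ℤ^E for a positive integer k. Fix e ∈ E and write w(e) = kq + r with integers q, r, 0 ≤ r ≤ k − 1. Then there exist integer vectors y_1, …, y_k ∈ B_f ∩ ℤ^E with w = y_1 + ⋯ + y_k such that y_i(e) = q + 1 for i = 1, …, r and y_i(e) ≤ q for i = r + 1, …, k. -/
open Finset

/-- Partial minimization of the submodular function `f` shifted by `-a` on sets containing `e`, over the element `e`,
preserves submodularity. -/
theorem SubmodularWithin.min_insert {E : Type*} [DecidableEq E] {S : Finset E}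
    {f : Finset E → ℤ} {e : E} (hf : SubmodularWithin (insert e S) f) (he : e ∉ S) {a : ℤ}
    (ha : a ≤ f {e}) : SubmodularWithin S fun U => min (f U) (f (insert e U) - a) := by
  refine ⟨by simp [hf.1, ha], fun A hA B hB => ?_⟩
  have hA' := insert_subset_insert e hA
  have hB' := insert_subset_insert e hB
  have heA : e ∉ A := fun h => he (hA h)
  have heB : e ∉ B := fun h => he (hB h)
  have h1 := hf.2 A (hA.trans (subset_insert e S)) B (hB.trans (subset_insert e S))
  have h2 := hf.2 A (hA.trans (subset_insert e S)) _ hB'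
  have h3 := hf.2 _ hA' B (hB.trans (subset_insert e S))
  have h4 := hf.2 _ hA' _ hB'
  rw [union_insert, inter_insert_of_notMem heA] at h2
  rw [insert_union, insert_inter_of_notMem heB] at h3
  rw [← insert_union_distrib, ← insert_inter_distrib] at h4
  grind

/-- If a modular function lies between `-h` and `f` whenever this is possible on `S`, then the same
holds on `insert e S`, with any value at `e` that satisfies the obvious bounds. -/
theorem exists_sandwich_insert {E : Type*} [DecidableEq E] {S : Finset E}
    (hS : ∀ f h : Finset E → ℤ, SubmodularWithin S f → SubmodularWithin S h →
      (∀ U ⊆ S, 0 ≤ f U + h U) →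
      ∃ y : E → ℤ, ∀ U ⊆ S, -h U ≤ ∑ i ∈ U, y i ∧ ∑ i ∈ U, y i ≤ f U)
    {e : E} (he : e ∉ S) {f h : Finset E → ℤ}
    (hf : SubmodularWithin (insert e S) f) (hh : SubmodularWithin (insert e S) h)
    (hfh : ∀ U ⊆ insert e S, 0 ≤ f U + h U) (a : ℤ)
    (ha : ∀ U ⊆ S, a ≤ f (insert e U) + h U)
    (ha' : ∀ U ⊆ S, -a ≤ f U + h (insert e U)) :
    ∃ y : E → ℤ, y e = a ∧
      ∀ U ⊆ insert e S, -h U ≤ ∑ i ∈ U, y i ∧ ∑ i ∈ U, y i ≤ f U := by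
  have ha0 : a ≤ f {e} := by simpa [hh.1] using ha ∅ (empty_subset S)
  have ha0' : -a ≤ h {e} := by simpa [hf.1] using ha' ∅ (empty_subset S)
  obtain ⟨y, hy⟩ := hS _ _ (hf.min_insert he ha0) (hh.min_insert he ha0') fun U hU => by
    have := ha U hU
    have := ha' U hU
    have := hfh U (hU.trans (subset_insert e S))
    have := hfh _ (insert_subset_insert e hU)
    grind
  refine ⟨Function.update y e a, by simp, fun U hU => ?_⟩
  by_cases heU : e ∈ U
  · have hsub : U.erase e ⊆ S := by rwa [← subset_insert_iff]
    have := hy _ hsub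
    rw [insert_erase heU] at this
    rw [← add_sum_erase U _ heU, Function.update_self,
      sum_update_of_notMem (notMem_erase e U)]
    grind
  · have hsub : U ⊆ S := (subset_insert_iff_of_notMem heU).1 hU
    have := hy U hsub
    rw [sum_update_of_notMem heU]
    grind

/-- **Discrete sandwich theorem** (Frank): between an integral supermodular function `-h` and an
integral submodular function `f` with `-h ≤ f` there is an integral modular function. -/
theorem exists_sandwich {E : Type*} [DecidableEq E] (S : Finset E) (f h : Finset E → ℤ)
    (hf : SubmodularWithin S f) (hh : SubmodularWithin S h) (hfh : ∀ U ⊆ S, 0 ≤ f U + h U) :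
    ∃ y : E → ℤ, ∀ U ⊆ S, -h U ≤ ∑ i ∈ U, y i ∧ ∑ i ∈ U, y i ≤ f U := by
  induction S using Finset.induction_on generalizing f h with
  | empty =>
    refine ⟨0, fun U hU => ?_⟩
    rw [subset_empty.1 hU]
    simp [hf.1, hh.1]
  | insert e S he ih =>
    obtain ⟨V, hV, hVmin⟩ := exists_min_image S.powerset (fun U => f (insert e U) + h U)
      ⟨∅, empty_mem_powerset S⟩
    rw [mem_powerset] at hV
    obtain ⟨y, -, hy⟩ := exists_sandwich_insert ih he hf hh hfh (f (insert e V) + h V)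
      (fun U hU => hVmin U (mem_powerset.2 hU)) fun U hU => by
        have heU : e ∉ U := fun h => he (hU h)
        have heV : e ∉ V := fun h => he (hV h)
        have h1 := hf.2 _ (insert_subset_insert e hV) U (hU.trans (subset_insert e S))
        have h2 := hh.2 V (hV.trans (subset_insert e S)) _ (insert_subset_insert e hU)
        rw [insert_union, insert_inter_of_notMem heU] at h1
        rw [union_insert, inter_insert_of_notMem heV] at h2
        have h3 := hfh _ (insert_subset_insert e (union_subset hV hU))
        have h4 := hfh (V ∩ U) ((inter_subset_left.trans hV).trans (subset_insert e S))
        linarith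
    exact ⟨y, hy⟩

/-- An integral vector of `(n + 1) · B_f` is the sum of an integral vector of `B_f` and one of
`n · B_f`, where the coordinate of the former at `e` is any prescribed rounding `a` of
`w e / (n + 1)`. -/
theorem Submodular.exists_summand {E : Type*} [Fintype E] [DecidableEq E] {f : Finset E → ℤ}
    (hf : Submodular f) {n : ℕ} {w : E → ℤ} (hw : ∀ U, ∑ i ∈ U, w i ≤ (n + 1) * f U)
    (hw' : ∑ i, w i = (n + 1) * f univ) {e : E} {a : ℤ}
    (ha : (n + 1) * (a - 1) < w e) (ha' : w e < (n + 1) * (a + 1)) :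
    ∃ y : E → ℤ, y e = a ∧ (∀ U, ∑ i ∈ U, y i ≤ f U) ∧ ∑ i, y i = f univ ∧
      (∀ U, ∑ i ∈ U, (w - y) i ≤ n * f U) ∧ ∑ i, (w - y) i = n * f univ := by
  have hn : (0 : ℤ) < n + 1 := by positivity
  have huniv : insert e (univ.erase e) = (univ : Finset E) := insert_erase (mem_univ e)
  have key (U : Finset E) : (n : ℤ) * ∑ i ∈ U, w i ≤ n * ((n + 1) * f U) :=
    mul_le_mul_of_nonneg_left (hw U) (by positivity)
  obtain ⟨y, hye, hy⟩ := exists_sandwich_insert (exists_sandwich (univ.erase e))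
    (notMem_erase e univ) (f := f) (h := fun U => n * f U - ∑ i ∈ U, w i) (a := a)
    ⟨hf.1, fun A _ B _ => hf.2 A B⟩
    ⟨by simp [hf.1], fun A _ B _ => by
      have h1 := mul_le_mul_of_nonneg_left (hf.2 A B) (Int.natCast_nonneg n)
      have h2 := sum_union_inter (s₁ := A) (s₂ := B) (f := w)
      linarith⟩
    (fun U _ => by linarith [hw U])
    (fun U hU => by
      have heU : e ∉ U := fun h => notMem_erase e univ (hU h)
      have h1 := hw (insert e U)
      rw [sum_insert heU] at h1
      have := key U
      have : a - 1 < f (insert e U) + (n * f U - ∑ i ∈ U, w i) :=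
        lt_of_mul_lt_mul_left (by linarith) hn.le
      linarith)
    (fun U hU => by
      have heU : e ∉ U := fun h => notMem_erase e univ (hU h)
      have h1 := key (insert e U)
      have h2 := hw U
      rw [sum_insert heU] at h1 ⊢
      have : -(a + 1) < f U + (n * f (insert e U) - (w e + ∑ i ∈ U, w i)) :=
        lt_of_mul_lt_mul_left (by linarith) hn.le
      linarith)
  rw [huniv] at hy
  have hU (U : Finset E) := hy U (subset_univ U)
  have htot : ∑ i, y i = f univ := le_antisymm (hU univ).2 (by linarith [(hU univ).1])
  refine ⟨y, hye, fun U => (hU U).2, htot, fun U => ?_, ?_⟩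
  · simp only [Pi.sub_apply, sum_sub_distrib]
    linarith [(hU U).1]
  · simp only [Pi.sub_apply, sum_sub_distrib]
    linarith

/-- Integer decomposition of `k · B_f` with coordinates at `e` as equal as possible. -/
theorem Submodular.exists_decomposition {E : Type*} [Fintype E] [DecidableEq E]
    {f : Finset E → ℤ} (hf : Submodular f) (k : ℕ) (w : E → ℤ)
    (hw : ∀ U, ∑ i ∈ U, w i ≤ k * f U) (hw' : ∑ i, w i = k * f univ)
    (e : E) (q : ℤ) (r : ℕ) (hqr : w e = k * q + r) (hrk : r ≤ k) :
    ∃ y : Fin k → (E → ℤ), (∀ i U, ∑ j ∈ U, y i j ≤ f U) ∧ (∀ i, ∑ j, y i j = f univ) ∧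
      w = ∑ i, y i ∧ ∀ i : Fin k, y i e = if (i : ℕ) < r then q + 1 else q := by
  induction k generalizing w r with
  | zero =>
    refine ⟨0, fun i => i.elim0, fun i => i.elim0, ?_, fun i => i.elim0⟩
    have hw0 (j : E) : w j ≤ 0 := by simpa using hw {j}
    have := (sum_eq_zero_iff_of_nonpos fun j _ => hw0 j).1 (by simpa using hw')
    ext j
    simpa using this j (mem_univ j)
  | succ n ih =>
    push_cast at hw hw' hqr
    obtain ⟨y, hye, hyU, hyE, hwU, hwE⟩ := hf.exists_summand hw hw' (e := e)
      (a := if 0 < r then q + 1 else q) (by split_ifs <;> grind) (by split_ifs <;> grind)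
    obtain ⟨z, hzU, hzE, hwz, hze⟩ := ih (w - y) hwU hwE (r - 1)
      (by rw [Pi.sub_apply, hye]; split_ifs <;> grind) (by lia)
    refine ⟨Fin.cons y z, Fin.cases hyU hzU, Fin.cases hyE hzE, ?_, Fin.cases ?_ fun i => ?_⟩
    · rw [Fin.sum_univ_succ]
      simp [← hwz]
    · exact hye
    · simp only [Fin.cons_succ, hze, Fin.val_succ]
      grind

/-- Let `w ∈ k·B_f ∩ ℤ^E` for a positive integer `k`, fix `e ∈ E` and
write `w(e) = kq + r` with `0 ≤ r ≤ k - 1`. Then `w = y₁ + ⋯ + y_k` for integer vectors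
`y_i ∈ B_f ∩ ℤ^E` with `y_i(e) = q + 1` for `i = 1, …, r` and `y_i(e) ≤ q` for
`i = r + 1, …, k`. -/
theorem decomposition_with_coordinate_control {E : Type*} [Fintype E] [DecidableEq E]
    (f : Finset E → ℤ) (hf : Submodular f) (hne : (basePolytope f).Nonempty)
    (k : ℕ) (hk : 0 < k) (w : E → ℤ)
    (hw : ∃ y ∈ basePolytope f, (fun e => (w e : ℝ)) = (k : ℝ) • y)
    (e : E) (q : ℤ) (r : ℕ) (hqr : w e = k * q + r) (hrk : r < k) :
    ∃ y : Fin k → (E → ℤ),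
      (∀ i, (fun e' => ((y i e' : ℤ) : ℝ)) ∈ basePolytope f) ∧
      w = ∑ i, y i ∧
      (∀ i : Fin k, (i : ℕ) < r → y i e = q + 1) ∧
      (∀ i : Fin k, r ≤ (i : ℕ) → y i e ≤ q) := by
  obtain ⟨x, ⟨hxU, hxE⟩, hwx⟩ := hw
  have hsum (U : Finset E) : ((∑ i ∈ U, w i : ℤ) : ℝ) = k * ∑ i ∈ U, x i := by
    push_cast
    rw [mul_sum]
    exact sum_congr rfl fun i _ => congrFun hwx i
  obtain ⟨y, hyU, hyE, hwy, hye⟩ := hf.exists_decomposition k w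
    (fun U => by
      have := mul_le_mul_of_nonneg_left (hxU U) (Nat.cast_nonneg (α := ℝ) k)
      rw [← hsum] at this
      exact_mod_cast this)
    (by
      have := hsum univ
      rw [hxE] at this
      exact_mod_cast this)
    e q r hqr hrk.le
  refine ⟨y, fun i => ⟨fun U => ?_, ?_⟩, hwy, fun i hi => ?_, fun i hi => ?_⟩
  · beta_reduce
    exact_mod_cast hyU i U
  · beta_reduce
    exact_mod_cast hyE i
  · rw [hye, if_pos hi]
  · rw [hye, if_neg hi.not_gt]
end
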